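/- arXiv:1902.10763 — 5 statements merged into one kernel-verified Lean document; each statement's English description precedes it below -/
import Mathlib

section
/- For every nonnegative integer k, (1/(2π)) ∫_{−2}^{2} t^{2k} √(4 − t²) dt = (1/(k+1))·binom(2k, k), i.e. the (2k)-th moment of the semicircle density equals the k-th Catalan number; moreover (1/(2π)) ∫_{−2}^{2} t^{2k+1} √(4 − t²) dt = 0, i.e. all odd moments of the semicircle density vanish. -/
/-- Integration by parts: consecutive even (or odd) unnormalised semicircle moments satisfy a
two-term recurrence. -/
theorem integral_pow_add_two_mul_sqrt_four_sub_sq (n : ℕ) :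
    (n + 4 : ℝ) * (∫ t in (-2:ℝ)..2, t ^ (n + 2) * Real.sqrt (4 - t ^ 2))
      = 4 * (n + 1) * (∫ t in (-2:ℝ)..2, t ^ n * Real.sqrt (4 - t ^ 2)) := by
  have hderiv : ∀ t ∈ Set.Ioo (-2:ℝ) 2,
      HasDerivAt (fun t : ℝ => t ^ (n + 1) * ((4 - t ^ 2) * Real.sqrt (4 - t ^ 2)))
        (4 * (n + 1) * (t ^ n * Real.sqrt (4 - t ^ 2))
          - (n + 4) * (t ^ (n + 2) * Real.sqrt (4 - t ^ 2))) t := by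
    intro t ht
    have hpos : 0 < 4 - t ^ 2 := by nlinarith [ht.1, ht.2]
    have hq : HasDerivAt (fun t : ℝ => 4 - t ^ 2) (-(2 * t)) t := by
      simpa using (hasDerivAt_pow 2 t).const_sub 4
    refine ((hasDerivAt_pow (n + 1) t).mul (hq.mul (hq.sqrt hpos.ne'))).congr_deriv ?_
    have hsqrt : Real.sqrt (4 - t ^ 2) ≠ 0 := (Real.sqrt_pos.2 hpos).ne'
    have hsq := Real.sq_sqrt hpos.le
    have hdiv : (4 - t ^ 2) * (-(2 * t) / (2 * Real.sqrt (4 - t ^ 2)))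
        = -t * Real.sqrt (4 - t ^ 2) := by
      field_simp
      rw [hsq]
    simp only [hdiv, Nat.add_sub_cancel, Pi.mul_apply]
    push_cast
    ring
  have hint := intervalIntegral.integral_eq_sub_of_hasDerivAt_of_le (by norm_num : (-2:ℝ) ≤ 2)
    (by fun_prop) hderiv (Continuous.intervalIntegrable (by fun_prop) _ _)
  rw [intervalIntegral.integral_sub (Continuous.intervalIntegrable (by fun_prop) _ _)
      (Continuous.intervalIntegrable (by fun_prop) _ _),
    intervalIntegral.integral_const_mul, intervalIntegral.integral_const_mul] at hint
  norm_num at hint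
  linarith

theorem integral_sqrt_four_sub_sq :
    ∫ t in (-2:ℝ)..2, Real.sqrt (4 - t ^ 2) = 2 * Real.pi := by
  have h := intervalIntegral.mul_integral_comp_mul_left (a := -1) (b := 1)
    (f := fun t : ℝ => Real.sqrt (4 - t ^ 2)) 2
  have hscale : ∀ x : ℝ, Real.sqrt (4 - (2 * x) ^ 2) = 2 * Real.sqrt (1 - x ^ 2) := by
    intro x
    rw [show 4 - (2 * x) ^ 2 = 2 ^ 2 * (1 - x ^ 2) by ring, Real.sqrt_mul (by norm_num),
      Real.sqrt_sq (by norm_num)]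
  simp only [hscale, intervalIntegral.integral_const_mul, integral_sqrt_one_sub_sq] at h
  norm_num at h
  linarith

theorem integral_pow_odd_mul_sqrt_four_sub_sq (k : ℕ) :
    ∫ t in (-2:ℝ)..2, t ^ (2 * k + 1) * Real.sqrt (4 - t ^ 2) = 0 := by
  have h := intervalIntegral.integral_comp_neg (a := -2) (b := 2)
    (fun t : ℝ => t ^ (2 * k + 1) * Real.sqrt (4 - t ^ 2))
  simp only [Odd.neg_pow (odd_two_mul_add_one k), neg_sq, neg_mul, neg_neg,
    intervalIntegral.integral_neg] at h
  linarith

theorem integral_pow_even_mul_sqrt_four_sub_sq (k : ℕ) :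
    ∫ t in (-2:ℝ)..2, t ^ (2 * k) * Real.sqrt (4 - t ^ 2)
      = 2 * Real.pi * ((Nat.centralBinom k : ℝ) / (k + 1)) := by
  induction k with
  | zero => simp [integral_sqrt_four_sub_sq]
  | succ k ih =>
    have hrec := integral_pow_add_two_mul_sqrt_four_sub_sq (2 * k)
    have hbinom : ((k : ℝ) + 1) * (k + 1).centralBinom = 2 * (2 * k + 1) * k.centralBinom := by
      exact_mod_cast Nat.succ_mul_centralBinom_succ k
    rw [ih] at hrec
    have hne : (2 * (k : ℝ) + 4) ≠ 0 := by positivity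
    push_cast at hrec ⊢
    refine mul_left_cancel₀ hne (hrec.trans ?_)
    have hk : (k : ℝ) + 1 ≠ 0 := by positivity
    have hk' : (k : ℝ) + 1 + 1 ≠ 0 := by positivity
    field_simp
    linear_combination (-2 * ((k : ℝ) + 2)) * hbinom

/-- The even moments of the standard semicircle density
`q(t) = (1/(2π))√(4 − t²)` on `[−2, 2]` are the Catalan numbers
`C_k = (1/(k+1))·binom(2k, k)`, and all odd moments vanish. -/
theorem semicircle_moments (k : ℕ) :
    (1 / (2 * Real.pi)) * (∫ t in (-2:ℝ)..2, t ^ (2 * k) * Real.sqrt (4 - t ^ 2))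
        = (Nat.choose (2 * k) k : ℝ) / (k + 1) ∧
    (1 / (2 * Real.pi)) * (∫ t in (-2:ℝ)..2, t ^ (2 * k + 1) * Real.sqrt (4 - t ^ 2)) = 0 := by
  refine ⟨?_, by rw [integral_pow_odd_mul_sqrt_four_sub_sq, mul_zero]⟩
  rw [integral_pow_even_mul_sqrt_four_sub_sq, Nat.centralBinom_eq_two_mul_choose, ← mul_assoc,
    one_div_mul_cancel (by positivity), one_mul]
end

section
/- Subordination for free convolution: Let μ and ν be Borel probability measures on ℝ with Cauchy transforms G_μ and G_ν. Then there exist holomorphic functions ω_1 : ℂ⁺ → ℂ⁺ and ω_2 : ℂ⁺ → ℂ⁺ such that for all z ∈ ℂ⁺: G_μ(ω_1(z)) = G_ν(ω_2(z)) and ω_1(z) + ω_2(z) − 1/G_μ(ω_1(z)) = z; moreover there exists a Borel probability measure ρ on ℝ (the free convolution μ ⊞ ν) such that G_ρ(z) = G_μ(ω_1(z)) for all z ∈ ℂ⁺. -/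
open MeasureTheory

/-- The Cauchy transform `G_ν(z) = ∫_ℝ 1/(z − t) dν(t)` of a Borel measure `ν`
on `ℝ`, defined for `z` in the upper half-plane. -/
noncomputable def cauchyTransform (ν : Measure ℝ) (z : ℂ) : ℂ :=
  ∫ t, (z - (t : ℂ))⁻¹ ∂ν

open Filter Topology Set Complex Metric

section SchwarzPick

/-- The squared distance to the conjugate point in terms of the squared distance. -/
lemma normSq_sub_conj (w b : ℂ) :
    normSq (w - (starRingEnd ℂ) b) = normSq (w - b) + 4 * w.im * b.im := by
  simp only [normSq_apply, sub_re, sub_im, conj_re, conj_im]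
  ring

lemma sub_conj_ne_zero {w b : ℂ} (hw : 0 < w.im) (hb : 0 < b.im) :
    w - (starRingEnd ℂ) b ≠ 0 := by
  intro h
  have := congrArg im h
  simp at this
  linarith

lemma norm_cayley_lt_one {w b : ℂ} (hw : 0 < w.im) (hb : 0 < b.im) :
    ‖(w - b) / (w - (starRingEnd ℂ) b)‖ < 1 := by
  rw [norm_div, div_lt_one (norm_pos_iff.2 (sub_conj_ne_zero hw hb)),
    ← sq_lt_sq₀ (norm_nonneg _) (norm_nonneg _), ← normSq_eq_norm_sq, ← normSq_eq_norm_sq,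
    normSq_sub_conj]
  have := mul_pos hw hb
  linarith

lemma im_cayley_symm_pos {a ζ : ℂ} (ha : 0 < a.im) (hζ : ‖ζ‖ < 1) :
    0 < ((a - (starRingEnd ℂ) a * ζ) / (1 - ζ)).im := by
  have h1 : (1 - ζ) ≠ 0 := by
    rintro h
    rw [sub_eq_zero] at h
    simp [← h] at hζ
  have h2 : normSq ζ < 1 := by
    rw [normSq_eq_norm_sq]
    nlinarith [norm_nonneg ζ]
  have : ((a - (starRingEnd ℂ) a * ζ) / (1 - ζ)).im
      = a.im * (1 - normSq ζ) / normSq (1 - ζ) := by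
    have h3 : normSq (1 - ζ) ≠ 0 := by simpa using h1
    rw [div_im]
    field_simp
    simp [normSq_apply]
    ring
  rw [this]
  have h3 := normSq_pos.2 h1
  have : 0 < 1 - normSq ζ := by linarith
  positivity

/-- **Schwarz–Pick lemma** on the upper half-plane, for maps into `{Im > c}`. -/
theorem schwarzPick_im {f : ℂ → ℂ} {c : ℝ} (hf : DifferentiableOn ℂ f {z : ℂ | 0 < z.im})
    (hc : ∀ z : ℂ, 0 < z.im → c < (f z).im) {a w : ℂ} (ha : 0 < a.im) (hw : 0 < w.im) :
    ‖f w - f a‖ ^ 2 * (w.im * a.im) ≤ ‖w - a‖ ^ 2 * (((f w).im - c) * ((f a).im - c)) := by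
  set g : ℂ → ℂ := fun z => f z - c * I with hg
  have hgim : ∀ z, (g z).im = (f z).im - c := by intro z; simp [hg]
  have hgpos : ∀ z : ℂ, 0 < z.im → 0 < (g z).im := by
    intro z hz
    rw [hgim]
    linarith [hc z hz]
  have hgd : DifferentiableOn ℂ g {z : ℂ | 0 < z.im} := hf.sub_const _
  set ψ : ℂ → ℂ := fun ζ => (a - (starRingEnd ℂ) a * ζ) / (1 - ζ) with hψ
  set F : ℂ → ℂ := fun ζ => (g (ψ ζ) - g a) / (g (ψ ζ) - (starRingEnd ℂ) (g a)) with hF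
  have hψpos : ∀ ζ ∈ ball (0 : ℂ) 1, 0 < (ψ ζ).im := fun ζ hζ =>
    im_cayley_symm_pos ha (by simpa using hζ)
  have hψd : DifferentiableOn ℂ ψ (ball 0 1) := by
    intro ζ hζ
    have h1 : (1 - ζ) ≠ 0 := by
      rintro h
      rw [sub_eq_zero] at h
      simp [← h] at hζ
    exact DifferentiableAt.differentiableWithinAt (by fun_prop (disch := assumption))
  have hgψ : DifferentiableOn ℂ (fun ζ => g (ψ ζ)) (ball 0 1) := hgd.comp hψd hψpos
  have hFd : DifferentiableOn ℂ F (ball 0 1) := by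
    refine DifferentiableOn.div (hgψ.sub_const _) (hgψ.sub_const _) ?_
    intro ζ hζ
    exact sub_conj_ne_zero (hgpos _ (hψpos ζ hζ)) (hgpos _ ha)
  have hF0 : F 0 = 0 := by simp [hF, hψ]
  have hFm : MapsTo F (ball 0 1) (closedBall 0 1) := by
    intro ζ hζ
    simpa [hF] using (norm_cayley_lt_one (hgpos _ (hψpos ζ hζ)) (hgpos _ ha)).le
  set ζ : ℂ := (w - a) / (w - (starRingEnd ℂ) a) with hζ
  have hζ1 : ‖ζ‖ < 1 := norm_cayley_lt_one hw ha
  have hψζ : ψ ζ = w := by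
    have h1 := sub_conj_ne_zero hw ha
    have h2 : a - (starRingEnd ℂ) a ≠ 0 := sub_conj_ne_zero ha ha
    have h3 : 1 - ζ = (a - (starRingEnd ℂ) a) / (w - (starRingEnd ℂ) a) := by
      rw [hζ]; field_simp; ring
    have h4 : a - (starRingEnd ℂ) a * ζ
        = w * (a - (starRingEnd ℂ) a) / (w - (starRingEnd ℂ) a) := by
      rw [hζ]; field_simp; ring
    simp only [hψ]
    rw [h3, h4]
    field_simp
  have key := Complex.norm_le_norm_of_mapsTo_ball hFd hFm hF0 hζ1
  have hFζ : F ζ = (g w - g a) / (g w - (starRingEnd ℂ) (g a)) := by simp only [hF, hψζ]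
  rw [hFζ, hζ, norm_div, norm_div] at key
  have e1 := norm_pos_iff.2 (sub_conj_ne_zero (hgpos w hw) (hgpos a ha))
  have e2 := norm_pos_iff.2 (sub_conj_ne_zero hw ha)
  rw [div_le_div_iff₀ e1 e2, ← sq_le_sq₀ (by positivity) (by positivity), mul_pow, mul_pow,
    ← normSq_eq_norm_sq (w - (starRingEnd ℂ) a),
    ← normSq_eq_norm_sq (g w - (starRingEnd ℂ) (g a)), normSq_sub_conj, normSq_sub_conj,
    normSq_eq_norm_sq, normSq_eq_norm_sq, hgim, hgim] at key
  have e3 : g w - g a = f w - f a := by simp [hg]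
  rw [e3] at key
  nlinarith

/-- The infinitesimal **Schwarz–Pick lemma** on the upper half-plane. -/
theorem schwarzPick_deriv {f : ℂ → ℂ} {c : ℝ} (hf : DifferentiableOn ℂ f {z : ℂ | 0 < z.im})
    (hc : ∀ z : ℂ, 0 < z.im → c < (f z).im) {a : ℂ} (ha : 0 < a.im) :
    ‖deriv f a‖ * a.im ≤ (f a).im - c := by
  have hopen : IsOpen {z : ℂ | 0 < z.im} := isOpen_lt continuous_const continuous_im
  have hda : DifferentiableAt ℂ f a := hf.differentiableAt (hopen.mem_nhds ha)
  have h1 : Tendsto (fun w => ‖slope f a w‖ ^ 2 * (w.im * a.im)) (𝓝[≠] a)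
      (𝓝 (‖deriv f a‖ ^ 2 * (a.im * a.im))) := by
    refine ((hasDerivAt_iff_tendsto_slope.1 hda.hasDerivAt).norm.pow 2).mul
      (Tendsto.mul_const _ ?_)
    exact (continuous_im.tendsto a).mono_left nhdsWithin_le_nhds
  have h2 : Tendsto (fun w => ((f w).im - c) * ((f a).im - c)) (𝓝[≠] a)
      (𝓝 (((f a).im - c) * ((f a).im - c))) := by
    refine Tendsto.mul_const _ (Tendsto.sub_const ?_ _)
    exact ((continuous_im.continuousAt.comp hda.continuousAt).tendsto).mono_left
      nhdsWithin_le_nhds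
  have h3 := le_of_tendsto_of_tendsto h1 h2 (by
    filter_upwards [self_mem_nhdsWithin, nhdsWithin_le_nhds (hopen.mem_nhds ha)] with w hwa hw
    have hpos : 0 < ‖w - a‖ := norm_pos_iff.2 (sub_ne_zero.2 hwa)
    have := schwarzPick_im hf hc ha hw
    rw [slope_def_field, norm_div, div_pow, div_mul_eq_mul_div, div_le_iff₀ (by positivity)]
    linarith)
  have h4 : 0 ≤ (f a).im - c := by linarith [hc a ha]
  refine abs_le_of_sq_le_sq' ?_ h4 |>.2
  nlinarith

end SchwarzPick

section CauchyTransform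

variable (μ : Measure ℝ) [IsProbabilityMeasure μ]

lemma isOpen_upperHalfPlane : IsOpen {z : ℂ | 0 < z.im} :=
  isOpen_lt continuous_const continuous_im

lemma im_le_norm_sub_ofReal (z : ℂ) (t : ℝ) : z.im ≤ ‖z - t‖ := by
  have := abs_im_le_norm (z - t)
  simp only [sub_im, ofReal_im, sub_zero] at this
  exact (le_abs_self _).trans this

lemma sub_ofReal_ne_zero {z : ℂ} (hz : 0 < z.im) (t : ℝ) : z - t ≠ 0 :=
  norm_pos_iff.1 (hz.trans_le (im_le_norm_sub_ofReal z t))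

lemma norm_inv_sub_ofReal_le {z : ℂ} (hz : 0 < z.im) (t : ℝ) : ‖(z - t)⁻¹‖ ≤ z.im⁻¹ := by
  rw [norm_inv]
  exact inv_anti₀ hz (im_le_norm_sub_ofReal z t)

lemma continuous_inv_sub_ofReal {z : ℂ} (hz : 0 < z.im) :
    Continuous fun t : ℝ => (z - (t : ℂ))⁻¹ :=
  Continuous.inv₀ (by fun_prop) (sub_ofReal_ne_zero hz)

lemma integrable_inv_sub_ofReal {z : ℂ} (hz : 0 < z.im) :
    Integrable (fun t : ℝ => (z - (t : ℂ))⁻¹) μ :=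
  Integrable.of_bound (continuous_inv_sub_ofReal hz).aestronglyMeasurable z.im⁻¹
    (ae_of_all _ (norm_inv_sub_ofReal_le hz))

lemma integrable_normSq_inv_sub_ofReal {z : ℂ} (hz : 0 < z.im) :
    Integrable (fun t : ℝ => ‖(z - (t : ℂ))⁻¹‖ ^ 2) μ := by
  refine Integrable.of_bound
    ((continuous_inv_sub_ofReal hz).norm.pow 2).aestronglyMeasurable (z.im⁻¹ ^ 2)
    (ae_of_all _ fun t => ?_)
  rw [Real.norm_of_nonneg (by positivity)]
  exact pow_le_pow_left₀ (norm_nonneg _) (norm_inv_sub_ofReal_le hz t) 2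

theorem differentiableOn_cauchyTransform :
    DifferentiableOn ℂ (cauchyTransform μ) {z : ℂ | 0 < z.im} := by
  intro z hz
  have h : cauchyTransform μ = fun z => -resolventTransform μ z := by
    ext w
    rw [cauchyTransform, resolventTransform_apply, ← integral_neg]
    congr 1
    ext t
    rw [resolvent, Ring.inverse_eq_inv', ← inv_neg, neg_sub]
    simp
  rw [h]
  refine (hasDerivAt_resolventTransform (μ := μ) z ?_).neg.differentiableAt.differentiableWithinAt
  rintro ⟨x, -, hx⟩
  have := congrArg im hx
  simp only [coe_algebraMap, ofReal_im] at this
  exact hz.ne this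

lemma im_inv_sub_ofReal (z : ℂ) (t : ℝ) :
    ((z - (t : ℂ))⁻¹).im = -(z.im * ‖(z - (t : ℂ))⁻¹‖ ^ 2) := by
  rw [← normSq_eq_norm_sq, normSq_inv, inv_im]
  simp [div_eq_mul_inv]

lemma im_cauchyTransform {z : ℂ} (hz : 0 < z.im) :
    (cauchyTransform μ z).im = -(z.im * ∫ t, ‖(z - (t : ℂ))⁻¹‖ ^ 2 ∂μ) := by
  rw [cauchyTransform, ← integral_const_mul, ← integral_neg]
  have := integral_im (𝕜 := ℂ) (integrable_inv_sub_ofReal μ hz)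
  simp only [RCLike.im_to_complex] at this
  rw [← this]
  simp_rw [im_inv_sub_ofReal]

lemma norm_cauchyTransform_sq_le {z : ℂ} (hz : 0 < z.im) :
    ‖cauchyTransform μ z‖ ^ 2 ≤ ∫ t, ‖(z - (t : ℂ))⁻¹‖ ^ 2 ∂μ := by
  set m := ∫ t, ‖(z - (t : ℂ))⁻¹‖ ∂μ with hm
  have hi := (integrable_inv_sub_ofReal μ hz).norm
  have h1 : ‖cauchyTransform μ z‖ ≤ m := norm_integral_le_integral_norm _
  have h2 : 0 ≤ ∫ t, (‖(z - (t : ℂ))⁻¹‖ - m) ^ 2 ∂μ := integral_nonneg fun t => sq_nonneg _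
  have h3 : ∫ t, (‖(z - (t : ℂ))⁻¹‖ - m) ^ 2 ∂μ
      = (∫ t, ‖(z - (t : ℂ))⁻¹‖ ^ 2 ∂μ) - m ^ 2 := by
    have : ∀ t : ℝ, (‖(z - (t : ℂ))⁻¹‖ - m) ^ 2
        = ‖(z - (t : ℂ))⁻¹‖ ^ 2 - 2 * m * ‖(z - (t : ℂ))⁻¹‖ + m ^ 2 := fun t => by ring
    have hi2 : Integrable (fun t : ℝ => ‖(z - (t : ℂ))⁻¹‖ ^ 2 - 2 * m * ‖(z - (t : ℂ))⁻¹‖) μ :=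
      (integrable_normSq_inv_sub_ofReal μ hz).sub (hi.const_mul _)
    simp_rw [this]
    rw [integral_add hi2 (integrable_const _), integral_sub (integrable_normSq_inv_sub_ofReal μ hz)
      (hi.const_mul _), integral_const_mul, ← hm]
    simp
    ring
  have := pow_le_pow_left₀ (norm_nonneg _) h1 2
  linarith

lemma im_cauchyTransform_neg {z : ℂ} (hz : 0 < z.im) : (cauchyTransform μ z).im < 0 := by
  rw [im_cauchyTransform μ hz, neg_lt_zero]
  refine mul_pos hz ((integral_pos_iff_support_of_nonneg (fun t => by positivity)
    (integrable_normSq_inv_sub_ofReal μ hz)).2 ?_)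
  have : (Function.support fun t : ℝ => ‖(z - (t : ℂ))⁻¹‖ ^ 2) = univ := by
    ext t
    simpa using sub_ofReal_ne_zero hz t
  rw [this]
  simp

lemma cauchyTransform_ne_zero {z : ℂ} (hz : 0 < z.im) : cauchyTransform μ z ≠ 0 := by
  intro h
  have := im_cauchyTransform_neg μ hz
  simp [h] at this

/-- The difference `F_μ(z) - z` between the reciprocal Cauchy transform and the identity. -/
noncomputable def reciprocalCauchySub (z : ℂ) : ℂ := (cauchyTransform μ z)⁻¹ - z

lemma differentiableOn_reciprocalCauchySub :
    DifferentiableOn ℂ (reciprocalCauchySub μ) {z : ℂ | 0 < z.im} :=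
  ((differentiableOn_cauchyTransform μ).inv fun _ hz => cauchyTransform_ne_zero μ hz).sub
    differentiableOn_id

lemma im_reciprocalCauchySub_nonneg {z : ℂ} (hz : 0 < z.im) :
    0 ≤ (reciprocalCauchySub μ z).im := by
  have h0 : 0 < normSq (cauchyTransform μ z) := normSq_pos.2 (cauchyTransform_ne_zero μ hz)
  rw [reciprocalCauchySub, sub_im, inv_im, im_cauchyTransform μ hz, neg_neg, sub_nonneg,
    le_div_iff₀ h0, normSq_eq_norm_sq]
  exact mul_le_mul_of_nonneg_left (norm_cauchyTransform_sq_le μ hz) hz.le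

/-- Nontangential asymptotics of the Cauchy transform at infinity. -/
theorem tendsto_mul_cauchyTransform {ι : Type*} {l : Filter ι} [l.IsCountablyGenerated]
    {b : ι → ℂ} {C : ℝ} (hb : Tendsto (fun i => (b i).im) l atTop)
    (hC : ∀ᶠ i in l, ‖b i‖ ≤ C * (b i).im) :
    Tendsto (fun i => b i * cauchyTransform μ (b i)) l (𝓝 1) := by
  have h : ∀ i, b i * cauchyTransform μ (b i) = ∫ t : ℝ, b i * (b i - (t : ℂ))⁻¹ ∂μ :=
    fun i => (integral_const_mul _ _).symm
  simp_rw [h]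
  have h1 : (1 : ℂ) = ∫ _ : ℝ, (1 : ℂ) ∂μ := by simp
  rw [h1]
  have hnorm : Tendsto (fun i => ‖b i‖) l atTop :=
    tendsto_atTop_mono (fun i => (le_abs_self _).trans (abs_im_le_norm _)) hb
  refine tendsto_integral_filter_of_dominated_convergence (fun _ => C) ?_ ?_
    (integrable_const _) ?_
  · filter_upwards [hb.eventually_gt_atTop 0] with i hi
    exact (continuous_const.mul (continuous_inv_sub_ofReal hi)).aestronglyMeasurable
  · filter_upwards [hb.eventually_gt_atTop 0, hC] with i hi hCi
    refine ae_of_all _ fun t => ?_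
    rw [norm_mul]
    calc ‖b i‖ * ‖(b i - (t : ℂ))⁻¹‖ ≤ (C * (b i).im) * (b i).im⁻¹ := by
          gcongr
          · exact (norm_nonneg _).trans hCi
          · exact norm_inv_sub_ofReal_le hi t
      _ = C := by field_simp
  · refine ae_of_all _ fun t => ?_
    have h2 : Tendsto (fun i => (t : ℂ) * (b i)⁻¹) l (𝓝 0) := by
      simpa using (tendsto_inv₀_cobounded.comp (tendsto_norm_atTop_iff_cobounded.1 hnorm)).const_mul
        (t : ℂ)
    have h3 : Tendsto (fun i => (1 - (t : ℂ) * (b i)⁻¹)⁻¹) l (𝓝 1) := by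
      simpa using (h2.const_sub 1).inv₀ (by simp)
    refine h3.congr' ?_
    filter_upwards [hb.eventually_gt_atTop 0] with i hi
    have h4 := sub_ofReal_ne_zero hi t
    have h5 : b i ≠ 0 := by
      intro h
      simp [h] at hi
    have h6 : 1 - (t : ℂ) * (b i)⁻¹ = (b i - t) * (b i)⁻¹ := by field_simp
    rw [h6, mul_inv, inv_inv, mul_comm]

theorem tendsto_reciprocalCauchySub_div {ι : Type*} {l : Filter ι} [l.IsCountablyGenerated]
    {b : ι → ℂ} {C : ℝ} (hb : Tendsto (fun i => (b i).im) l atTop)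
    (hC : ∀ᶠ i in l, ‖b i‖ ≤ C * (b i).im) :
    Tendsto (fun i => reciprocalCauchySub μ (b i) / b i) l (𝓝 0) := by
  have h := ((tendsto_mul_cauchyTransform μ hb hC).inv₀ one_ne_zero).sub_const 1
  simp only [inv_one, sub_self] at h
  refine h.congr' ?_
  filter_upwards [hb.eventually_gt_atTop 0] with i hi
  have h5 : b i ≠ 0 := by
    intro h
    simp [h] at hi
  rw [reciprocalCauchySub]
  field_simp

end CauchyTransform

section FixedPoint

/-- A holomorphic self-map of the upper half-plane with image in a compact subset has a
fixed point. -/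
theorem exists_fixedPoint_of_bounded {f : ℂ → ℂ} {m R : ℝ}
    (hf : DifferentiableOn ℂ f {z : ℂ | 0 < z.im}) (hm : 0 < m)
    (him : ∀ z : ℂ, 0 < z.im → m ≤ (f z).im) (hR : ∀ z : ℂ, 0 < z.im → ‖f z‖ ≤ R) :
    ∃ a : ℂ, 0 < a.im ∧ f a = a := by
  set K : Set ℂ := closedBall 0 R ∩ {z | m ≤ z.im} with hK
  have hKc : IsCompact K :=
    (isCompact_closedBall _ _).inter_right (isClosed_le continuous_const continuous_im)
  have hKpos : ∀ z ∈ K, 0 < z.im := fun z hz => hm.trans_le hz.2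
  have hfK : ∀ z : ℂ, 0 < z.im → f z ∈ K := fun z hz => ⟨by simpa using hR z hz, him z hz⟩
  have hKne : K.Nonempty := ⟨f I, hfK I (by simp)⟩
  have hcont : ContinuousOn (fun z => ‖f z - z‖ ^ 2 / ((f z).im * z.im)) K := by
    have hfc : ContinuousOn f K := hf.continuousOn.mono hKpos
    refine ContinuousOn.div ((hfc.sub continuousOn_id).norm.pow 2)
      ((continuous_im.comp_continuousOn hfc).mul continuous_im.continuousOn) ?_
    intro z hz
    exact (mul_pos (hKpos _ (hfK z (hKpos z hz))) (hKpos z hz)).ne'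
  obtain ⟨a, haK, ha⟩ := hKc.exists_isMinOn hKne hcont
  have hapos := hKpos a haK
  refine ⟨a, hapos, ?_⟩
  by_contra hne
  have h1 := hfK a hapos
  have h1pos := hKpos _ h1
  have h2 := hfK _ h1pos
  have h2pos := hKpos _ h2
  have hmin : ‖f a - a‖ ^ 2 / ((f a).im * a.im)
      ≤ ‖f (f a) - f a‖ ^ 2 / ((f (f a)).im * (f a).im) := ha h1
  have hsp := schwarzPick_im (c := m / 2) hf
    (fun z hz => (half_lt_self hm).trans_le (him z hz)) hapos h1pos
  rw [div_le_div_iff₀ (mul_pos h1pos hapos) (mul_pos h2pos h1pos)] at hmin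
  have hlt : ((f (f a)).im - m / 2) * ((f a).im - m / 2) < (f (f a)).im * (f a).im := by
    have := h1.2
    have := h2.2
    simp only [mem_ofPred_eq] at *
    nlinarith
  have hpos : 0 < ‖f a - a‖ ^ 2 := pow_pos (norm_pos_iff.2 (sub_ne_zero.2 hne)) 2
  have := mul_lt_mul_of_pos_left hlt hpos
  linarith

/-- The map `w ↦ w / (1 - iδw)`, that is `-1/w ↦ -1/w + iδ`, which pushes the upper half-plane
into a horodisc. -/
noncomputable def horoPush (δ : ℝ) (w : ℂ) : ℂ := w / (1 - I * δ * w)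

variable {δ : ℝ} {w : ℂ}

lemma normSq_one_sub_mul (δ : ℝ) (w : ℂ) :
    normSq (1 - I * δ * w) = 1 + 2 * δ * w.im + δ ^ 2 * normSq w := by
  simp only [normSq_apply, sub_re, sub_im, one_re, one_im, mul_re, mul_im, I_re, I_im, ofReal_re,
    ofReal_im]
  ring

lemma normSq_one_sub_mul_pos (hδ : 0 < δ) (hw : 0 < w.im) : 0 < normSq (1 - I * δ * w) := by
  rw [normSq_one_sub_mul]
  have := normSq_nonneg w
  positivity

lemma one_sub_mul_ne_zero (hδ : 0 < δ) (hw : 0 < w.im) : 1 - I * δ * w ≠ 0 :=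
  normSq_pos.1 (normSq_one_sub_mul_pos hδ hw)

lemma differentiableOn_horoPush (hδ : 0 < δ) :
    DifferentiableOn ℂ (horoPush δ) {z : ℂ | 0 < z.im} := by
  intro w hw
  have := one_sub_mul_ne_zero hδ hw
  unfold horoPush
  exact DifferentiableAt.differentiableWithinAt (by fun_prop (disch := assumption))

lemma norm_horoPush_le (hδ : 0 < δ) (hw : 0 < w.im) : ‖horoPush δ w‖ ≤ δ⁻¹ := by
  have h := one_sub_mul_ne_zero hδ hw
  rw [horoPush, norm_div, div_le_iff₀ (norm_pos_iff.2 h), inv_mul_eq_div, le_div_iff₀ hδ,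
    ← sq_le_sq₀ (by positivity) (by positivity), mul_pow, ← normSq_eq_norm_sq,
    ← normSq_eq_norm_sq, normSq_one_sub_mul]
  have := mul_pos hδ hw
  linarith

lemma im_horoPush (hδ : 0 < δ) (hw : 0 < w.im) :
    (horoPush δ w).im = (w.im + δ * normSq w) / normSq (1 - I * δ * w) := by
  have h := normSq_one_sub_mul_pos hδ hw
  rw [horoPush, div_im]
  field_simp
  simp only [normSq_apply, sub_re, sub_im, one_re, one_im, mul_re, mul_im, I_re, I_im, ofReal_re,
    ofReal_im]
  ring

lemma le_im_horoPush (hδ : 0 < δ) {c m : ℝ} (hw : 0 < w.im) (hc : c ≤ w.im)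
    (hmc : m ≤ c / 2) (hmδ : m * δ ≤ 1 / 4) : m ≤ (horoPush δ w).im := by
  rw [im_horoPush hδ hw, le_div_iff₀ (normSq_one_sub_mul_pos hδ hw), normSq_one_sub_mul]
  have h1 : m * δ * w.im ≤ 1 / 4 * w.im := mul_le_mul_of_nonneg_right hmδ hw.le
  have h2 : m * δ * (δ * normSq w) ≤ 1 / 4 * (δ * normSq w) :=
    mul_le_mul_of_nonneg_right hmδ (mul_nonneg hδ.le (normSq_nonneg w))
  have h3 : 0 ≤ δ * normSq w := mul_nonneg hδ.le (normSq_nonneg w)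
  nlinarith

lemma tendsto_horoPush {ι : Type*} {l : Filter ι} {d : ι → ℝ} {x : ι → ℂ} {y : ℂ}
    (hd : Tendsto d l (𝓝 0)) (hx : Tendsto x l (𝓝 y)) :
    Tendsto (fun i => horoPush (d i) (x i)) l (𝓝 y) := by
  have h1 : Tendsto (fun i => 1 - I * (d i : ℂ) * x i) l (𝓝 (1 - I * (0 : ℝ) * y)) :=
    (((continuous_ofReal.tendsto _).comp hd).const_mul I |>.mul hx).const_sub 1
  simp only [ofReal_zero, mul_zero, zero_mul, sub_zero] at h1
  have h2 := hx.div h1 one_ne_zero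
  rwa [div_one] at h2

lemma tendsto_norm_sub_div_norm {ι : Type*} {l : Filter ι} {x b : ι → ℂ} {y : ℂ}
    (hx : Tendsto x l (𝓝 y)) (hb : Tendsto (fun i => ‖b i‖) l atTop) :
    Tendsto (fun i => ‖x i - b i‖ / ‖b i‖) l (𝓝 1) := by
  have h1 : Tendsto (fun i => x i * (b i)⁻¹) l (𝓝 (y * 0)) :=
    hx.mul (tendsto_inv₀_cobounded.comp (tendsto_norm_atTop_iff_cobounded.1 hb))
  have h2 : Tendsto (fun i => ‖x i * (b i)⁻¹ - 1‖) l (𝓝 1) := by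
    simpa using (h1.sub_const 1).norm
  refine h2.congr' ?_
  filter_upwards [hb.eventually_gt_atTop 0] with i hi
  rw [← norm_div, sub_div, div_self (norm_pos_iff.1 hi), div_eq_mul_inv]

/-- If the solutions of the regularised coupled fixed point equations do not escape to infinity,
then they accumulate at a solution of the coupled fixed point equations. -/
lemma exists_coupled_of_not_tendsto {A B : ℂ → ℂ} {m : ℝ}
    (hA : DifferentiableOn ℂ A {z : ℂ | 0 < z.im}) (hB : DifferentiableOn ℂ B {z : ℂ | 0 < z.im})
    (hm : 0 < m) (hAm : ∀ z : ℂ, 0 < z.im → m ≤ (A z).im)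
    {d : ℕ → ℝ} (hd : Tendsto d atTop (𝓝 0)) {a b : ℕ → ℂ} (ham : ∀ n, m ≤ (a n).im)
    (hb : ∀ n, horoPush (d n) (A (a n)) = b n) (ha : ∀ n, horoPush (d n) (B (b n)) = a n)
    (hnt : ¬ Tendsto (fun n => ‖a n‖) atTop atTop) :
    ∃ x y : ℂ, 0 < x.im ∧ 0 < y.im ∧ A x = y ∧ B y = x := by
  obtain ⟨R, hR⟩ : ∃ R : ℝ, ∃ᶠ n in atTop, a n ∈ closedBall (0 : ℂ) R := by
    rw [Filter.tendsto_atTop] at hnt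
    push Not at hnt
    obtain ⟨R, hR⟩ := hnt
    exact ⟨R, hR.mono fun n hn => by simpa using hn.le⟩
  obtain ⟨x, -, φ, hφ, hx⟩ := tendsto_subseq_of_frequently_bounded isBounded_closedBall hR
  have hxm : m ≤ x.im :=
    ge_of_tendsto' ((continuous_im.tendsto x).comp hx) fun n => ham _
  have hxpos := hm.trans_le hxm
  have hypos : 0 < (A x).im := hm.trans_le (hAm x hxpos)
  have hcA : ContinuousAt A x :=
    (hA.differentiableAt (isOpen_upperHalfPlane.mem_nhds hxpos)).continuousAt
  have hcB : ContinuousAt B (A x) :=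
    (hB.differentiableAt (isOpen_upperHalfPlane.mem_nhds hypos)).continuousAt
  have hd' := hd.comp hφ.tendsto_atTop
  have hb' : Tendsto (b ∘ φ) atTop (𝓝 (A x)) :=
    (tendsto_horoPush hd' (hcA.tendsto.comp hx)).congr fun n => hb _
  have ha' : Tendsto (a ∘ φ) atTop (𝓝 (B (A x))) :=
    (tendsto_horoPush hd' (hcB.tendsto.comp hb')).congr fun n => ha _
  exact ⟨x, A x, hxpos, hypos, rfl, tendsto_nhds_unique ha' hx⟩

/-- Existence of a coupled fixed point of two holomorphic maps on the upper half-plane. -/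
theorem exists_coupled_fixedPoint {A B : ℂ → ℂ} {c : ℝ}
    (hA : DifferentiableOn ℂ A {z : ℂ | 0 < z.im}) (hB : DifferentiableOn ℂ B {z : ℂ | 0 < z.im})
    (hc : 0 < c) (hAc : ∀ z : ℂ, 0 < z.im → c ≤ (A z).im)
    (hBc : ∀ z : ℂ, 0 < z.im → c ≤ (B z).im)
    {w u : ℂ} (hw : 0 < w.im) (hu : 0 < u.im) (hwu : (A w).im * (B u).im < w.im * u.im) :
    ∃ x y : ℂ, 0 < x.im ∧ 0 < y.im ∧ A x = y ∧ B y = x := by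
  have hApos : ∀ z : ℂ, 0 < z.im → 0 < (A z).im := fun z hz => hc.trans_le (hAc z hz)
  have hBpos : ∀ z : ℂ, 0 < z.im → 0 < (B z).im := fun z hz => hc.trans_le (hBc z hz)
  set d : ℕ → ℝ := fun n => 1 / ((n : ℝ) + 1) with hd
  have hdlim : Tendsto d atTop (𝓝 0) := tendsto_one_div_add_atTop_nhds_zero_nat
  have hdpos : ∀ n, 0 < d n := fun n => by positivity
  have hdle : ∀ n, d n ≤ 1 := fun n => by
    rw [hd, div_le_one (by positivity)]
    linarith [(Nat.cast_nonneg n : (0 : ℝ) ≤ n)]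
  set m : ℝ := min (c / 2) (1 / 4) with hm
  have hmpos : 0 < m := by positivity
  have hmc : m ≤ c / 2 := min_le_left _ _
  have hmd : ∀ n, m * d n ≤ 1 / 4 := fun n => by
    have : m ≤ 1 / 4 := min_le_right _ _
    nlinarith [hdpos n, hdle n]
  have hAd : ∀ n, DifferentiableOn ℂ (fun z => horoPush (d n) (A z)) {z : ℂ | 0 < z.im} :=
    fun n => (differentiableOn_horoPush (hdpos n)).comp hA hApos
  have hBd : ∀ n, DifferentiableOn ℂ (fun z => horoPush (d n) (B z)) {z : ℂ | 0 < z.im} :=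
    fun n => (differentiableOn_horoPush (hdpos n)).comp hB hBpos
  have hAm : ∀ n (z : ℂ), 0 < z.im → m ≤ (horoPush (d n) (A z)).im := fun n z hz =>
    le_im_horoPush (hdpos n) (hApos z hz) (hAc z hz) hmc (hmd n)
  have hBm : ∀ n (z : ℂ), 0 < z.im → m ≤ (horoPush (d n) (B z)).im := fun n z hz =>
    le_im_horoPush (hdpos n) (hBpos z hz) (hBc z hz) hmc (hmd n)
  have hex : ∀ n, ∃ a : ℂ, 0 < a.im ∧
      horoPush (d n) (B (horoPush (d n) (A a))) = a := fun n =>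
    exists_fixedPoint_of_bounded (R := (d n)⁻¹)
      ((hBd n).comp (hAd n) fun z hz => hmpos.trans_le (hAm n z hz)) hmpos
      (fun z hz => hBm n _ (hmpos.trans_le (hAm n z hz)))
      (fun z hz => norm_horoPush_le (hdpos n) (hBpos _ (hmpos.trans_le (hAm n z hz))))
  choose a hapos ha using hex
  set b : ℕ → ℂ := fun n => horoPush (d n) (A (a n)) with hb
  have hbm : ∀ n, m ≤ (b n).im := fun n => hAm n _ (hapos n)
  have hbpos : ∀ n, 0 < (b n).im := fun n => hmpos.trans_le (hbm n)
  have ham : ∀ n, m ≤ (a n).im := fun n => by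
    rw [← ha n]
    exact hBm n _ (hbpos n)
  by_cases hat : Tendsto (fun n => ‖a n‖) atTop atTop
  swap
  · exact exists_coupled_of_not_tendsto hA hB hmpos (fun z hz => by linarith [hAc z hz]) hdlim
      ham (fun n => rfl) ha hat
  by_cases hbt : Tendsto (fun n => ‖b n‖) atTop atTop
  swap
  · obtain ⟨x, y, hx, hy, h1, h2⟩ := exists_coupled_of_not_tendsto hB hA hmpos
      (fun z hz => by linarith [hBc z hz]) hdlim hbm ha (fun n => rfl) hbt
    exact ⟨y, x, hy, hx, h2, h1⟩
  exfalso
  have hAw : Tendsto (fun n => horoPush (d n) (A w)) atTop (𝓝 (A w)) :=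
    tendsto_horoPush hdlim tendsto_const_nhds
  have hBu : Tendsto (fun n => horoPush (d n) (B u)) atTop (𝓝 (B u)) :=
    tendsto_horoPush hdlim tendsto_const_nhds
  have hl := (((tendsto_norm_sub_div_norm hAw hbt).pow 2).mul
    ((tendsto_norm_sub_div_norm hBu hat).pow 2)).mul_const (w.im * u.im)
  have hr := (((tendsto_norm_sub_div_norm (tendsto_const_nhds (x := w)) hat).pow 2).mul
    ((tendsto_norm_sub_div_norm (tendsto_const_nhds (x := u)) hbt).pow 2)).mul
    (((continuous_im.tendsto _).comp hAw).mul ((continuous_im.tendsto _).comp hBu))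
  have hle := le_of_tendsto_of_tendsto hl hr (by
    filter_upwards [hat.eventually_gt_atTop 0, hbt.eventually_gt_atTop 0] with n hna hnb
    have s1 := schwarzPick_im (c := 0) (hAd n) (fun z hz => hmpos.trans_le (hAm n z hz))
      (hapos n) hw
    have s2 := schwarzPick_im (c := 0) (hBd n) (fun z hz => hmpos.trans_le (hBm n z hz))
      (hbpos n) hu
    have e1 : horoPush (d n) (A (a n)) = b n := rfl
    have e2 : horoPush (d n) (B (b n)) = a n := ha n
    simp only [e1, e2, sub_zero] at s1 s2
    have hab : 0 < (a n).im * (b n).im := mul_pos (hapos n) (hbpos n)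
    have hwp : 0 < (horoPush (d n) (A w)).im := hmpos.trans_le (hAm n w hw)
    have s3 := mul_le_mul s1 s2 (by have := hbpos n; positivity)
      (by have := hbpos n; positivity)
    have s4 : ‖horoPush (d n) (A w) - b n‖ ^ 2 * ‖horoPush (d n) (B u) - a n‖ ^ 2
        * (w.im * u.im) ≤ ‖w - a n‖ ^ 2 * ‖u - b n‖ ^ 2
        * ((horoPush (d n) (A w)).im * (horoPush (d n) (B u)).im) := by
      refine le_of_mul_le_mul_right ?_ hab
      linarith
    simp only [div_pow, Function.comp]
    rw [div_mul_div_comm, div_mul_div_comm, div_mul_eq_mul_div, div_mul_eq_mul_div,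
      mul_comm (‖b n‖ ^ 2)]
    exact div_le_div_of_nonneg_right s4 (by positivity))
  simp only [one_pow, one_mul] at hle
  linarith

end FixedPoint

section Subordination

variable {h₁ h₂ : ℂ → ℂ}

lemma im_le_im_add {h : ℂ → ℂ} (hh : ∀ z, 0 < z.im → 0 ≤ (h z).im) (z : ℂ) {w : ℂ}
    (hw : 0 < w.im) : z.im ≤ (z + h w).im := by
  rw [add_im]
  linarith [hh w hw]

/-- The map `w ↦ z + h₂ (z + h₁ w)` is holomorphic on the upper half-plane. -/
lemma differentiableOn_add_comp_add (hd₁ : DifferentiableOn ℂ h₁ {z | 0 < z.im})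
    (hd₂ : DifferentiableOn ℂ h₂ {z | 0 < z.im}) (hi₁ : ∀ z, 0 < z.im → 0 ≤ (h₁ z).im)
    {z : ℂ} (hz : 0 < z.im) :
    DifferentiableOn ℂ (fun w => z + h₂ (z + h₁ w)) {z | 0 < z.im} :=
  (hd₂.comp (hd₁.const_add z) fun _ hw => hz.trans_le (im_le_im_add hi₁ _ hw)).const_add z

lemma eq_of_fixedPoint (hd₁ : DifferentiableOn ℂ h₁ {z | 0 < z.im})
    (hd₂ : DifferentiableOn ℂ h₂ {z | 0 < z.im}) (hi₁ : ∀ z, 0 < z.im → 0 ≤ (h₁ z).im)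
    (hi₂ : ∀ z, 0 < z.im → 0 ≤ (h₂ z).im) {z a b : ℂ} (hz : 0 < z.im) (ha : 0 < a.im)
    (hb : 0 < b.im) (hfa : z + h₂ (z + h₁ a) = a) (hfb : z + h₂ (z + h₁ b) = b) : a = b := by
  have hlow : ∀ w : ℂ, 0 < w.im → z.im / 2 < (z + h₂ (z + h₁ w)).im := fun w hw => by
    have := im_le_im_add hi₂ z (hz.trans_le (im_le_im_add hi₁ _ hw))
    linarith
  have h := schwarzPick_im (differentiableOn_add_comp_add hd₁ hd₂ hi₁ hz) hlow ha hb
  have ha' := hlow a ha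
  have hb' := hlow b hb
  simp only [hfa, hfb] at h ha' hb'
  by_contra hne
  have hpos : 0 < ‖b - a‖ ^ 2 := by
    have := norm_pos_iff.2 (sub_ne_zero.2 (Ne.symm hne))
    positivity
  have h' := le_of_mul_le_mul_left h hpos
  nlinarith

lemma differentiableOn_of_fixedPoint (hd₁ : DifferentiableOn ℂ h₁ {z | 0 < z.im})
    (hd₂ : DifferentiableOn ℂ h₂ {z | 0 < z.im}) (hi₁ : ∀ z, 0 < z.im → 0 ≤ (h₁ z).im)
    (hi₂ : ∀ z, 0 < z.im → 0 ≤ (h₂ z).im) {ω : ℂ → ℂ} (hω : ∀ z, 0 < z.im → 0 < (ω z).im)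
    (hfix : ∀ z, 0 < z.im → z + h₂ (z + h₁ (ω z)) = ω z) :
    DifferentiableOn ℂ ω {z | 0 < z.im} := by
  intro z hz
  have hz' : 0 < z.im := hz
  have hop := isOpen_upperHalfPlane
  have hc₁ : ContDiffAt ℂ 1 h₁ (ω z) :=
    (hd₁.analyticAt (hop.mem_nhds (hω z hz))).contDiffAt
  have hc₂ : ContDiffAt ℂ 1 h₂ (z + h₁ (ω z)) :=
    (hd₂.analyticAt (hop.mem_nhds (hz'.trans_le (im_le_im_add hi₁ _ (hω z hz))))).contDiffAt
  let f : ℂ × ℂ → ℂ := fun p => p.2 - p.1 - h₂ (p.1 + h₁ p.2)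
  have hin : ContDiffAt ℂ 1 (fun p : ℂ × ℂ => p.1 + h₁ p.2) (z, ω z) :=
    contDiffAt_fst.add (ContDiffAt.comp (z, ω z) hc₁ contDiffAt_snd)
  have hf : ContDiffAt ℂ 1 f (z, ω z) :=
    (contDiffAt_snd.sub contDiffAt_fst).sub (ContDiffAt.comp (z, ω z) hc₂ hin)
  have hgd := differentiableOn_add_comp_add hd₁ hd₂ hi₁ hz'
  set g : ℂ → ℂ := fun w => z + h₂ (z + h₁ w) with hg
  have hlow : ∀ w : ℂ, 0 < w.im → z.im / 2 < (g w).im := fun w hw => by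
    have := im_le_im_add hi₂ z (hz'.trans_le (im_le_im_add hi₁ _ hw))
    simp only [hg]
    linarith
  have hder := schwarzPick_deriv hgd hlow (hω z hz)
  have hne : 1 - deriv g (ω z) ≠ 0 := by
    intro h0
    have h1 : deriv g (ω z) = 1 := (sub_eq_zero.1 h0).symm
    rw [h1, norm_one, one_mul, hg] at hder
    simp only [hfix z hz] at hder
    linarith
  have hpart : HasDerivAt (fun w => f (z, w)) (1 - deriv g (ω z)) (ω z) := by
    have h1 := (hasDerivAt_id (ω z)).sub (hgd.differentiableAt (hop.mem_nhds (hω z hz))).hasDerivAt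
    refine h1.congr_of_eventuallyEq (Eventually.of_forall fun w => ?_)
    simp only [f, hg, Pi.sub_apply, id]
    ring
  have hcomp : HasFDerivAt (fun w => f (z, w)) (fderiv ℂ f (z, ω z) ∘L .inr ℂ ℂ ℂ) (ω z) :=
    ((hf.differentiableAt one_ne_zero).hasFDerivAt).comp (ω z) (hasFDerivAt_prodMk_right z (ω z))
  have hinv : (fderiv ℂ f (z, ω z) ∘L .inr ℂ ℂ ℂ).IsInvertible := by
    rw [hcomp.unique hpart.hasFDerivAt]
    refine ⟨ContinuousLinearEquiv.unitsEquivAut ℂ (Units.mk0 _ hne), ?_⟩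
    ext
    simp
  have hψ := hf.contDiffAt_implicitFunction one_ne_zero hinv
  have hψ0 := hf.implicitFunction_apply_self one_ne_zero hinv
  have hψf := hf.eventually_apply_implicitFunction one_ne_zero hinv
  set ψ := hf.implicitFunction one_ne_zero hinv
  have hψim : ∀ᶠ x in 𝓝 z, 0 < (ψ x).im := by
    have : ContinuousAt ψ z := hψ.continuousAt
    refine this.eventually (hop.mem_nhds ?_)
    simp only [hψ0]
    exact hω z hz
  have heq : ω =ᶠ[𝓝 z] ψ := by
    filter_upwards [hψim, hψf, hop.mem_nhds hz] with x hx hfx hxp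
    refine eq_of_fixedPoint hd₁ hd₂ hi₁ hi₂ hxp (hω x hxp) hx (hfix x hxp) ?_
    have h1 := hfix z hz
    simp only [f] at hfx
    linear_combination h1 - hfx
  exact ((hψ.differentiableAt one_ne_zero).congr_of_eventuallyEq heq).differentiableWithinAt

lemma tendsto_im_div_zero (μ : Measure ℝ) [IsProbabilityMeasure μ] (z : ℂ) :
    Tendsto (fun y : ℝ => (z + reciprocalCauchySub μ (I * y)).im / y) atTop (𝓝 0) := by
  have h1 : Tendsto (fun y : ℝ => reciprocalCauchySub μ (I * y) / (I * y)) atTop (𝓝 0) :=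
    tendsto_reciprocalCauchySub_div (C := 1) μ (by simpa using! tendsto_id) (by
      filter_upwards [eventually_gt_atTop 0] with y hy
      simp [abs_of_pos hy])
  have h2 : Tendsto (fun y : ℝ => z.im / y) atTop (𝓝 0) := tendsto_const_nhds.div_atTop tendsto_id
  have h3 := h2.add ((continuous_re.tendsto _).comp h1)
  simp only [zero_re, add_zero] at h3
  refine h3.congr' ?_
  filter_upwards [eventually_gt_atTop 0] with y hy
  have : reciprocalCauchySub μ (I * y) / (I * y) = ((-I) * reciprocalCauchySub μ (I * y)) / y := by
    have hy' : (y : ℂ) ≠ 0 := by exact_mod_cast hy.ne'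
    field_simp
    rw [I_sq]
    ring
  simp only [Function.comp, this, div_ofReal_re]
  simp [add_div]

lemma exists_subordination_point (μ ν : Measure ℝ) [IsProbabilityMeasure μ]
    [IsProbabilityMeasure ν] {z : ℂ} (hz : 0 < z.im) :
    ∃ w : ℂ, 0 < w.im ∧
      z + reciprocalCauchySub ν (z + reciprocalCauchySub μ w) = w := by
  have hl : ∀ ρ : Measure ℝ, ∀ [IsProbabilityMeasure ρ], ∀ᶠ y : ℝ in atTop,
      (z + reciprocalCauchySub ρ (I * y)).im < y := fun ρ _ => by
    filter_upwards [(tendsto_im_div_zero ρ z).eventually_lt_const zero_lt_one,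
      eventually_gt_atTop 0] with y hy hy0
    rwa [div_lt_one hy0] at hy
  obtain ⟨y, hy1, hy2, hy0⟩ := ((hl μ).and ((hl ν).and (eventually_gt_atTop 0))).exists
  have hpos : 0 < (I * (y : ℂ)).im := by simpa using hy0
  have hA := im_le_im_add (fun w hw => im_reciprocalCauchySub_nonneg μ hw) z hpos
  obtain ⟨x, v, hx, -, hxv, hvx⟩ := exists_coupled_fixedPoint
    ((differentiableOn_reciprocalCauchySub μ).const_add z)
    ((differentiableOn_reciprocalCauchySub ν).const_add z) hz
    (fun w hw => im_le_im_add (fun w hw => im_reciprocalCauchySub_nonneg μ hw) _ hw)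
    (fun w hw => im_le_im_add (fun w hw => im_reciprocalCauchySub_nonneg ν hw) _ hw)
    hpos hpos (by
      simp only [I_mul_im, ofReal_re]
      exact mul_lt_mul'' hy1 hy2 (hz.le.trans hA)
        (hz.le.trans (im_le_im_add (fun w hw => im_reciprocalCauchySub_nonneg ν hw) _ hpos)))
  exact ⟨x, hx, by rw [hxv, hvx]⟩

/-- A holomorphic self-map of the upper half-plane stays in a fixed Stolz angle along the
imaginary axis, as soon as it does not decrease imaginary parts. -/
lemma exists_norm_le_im {ω : ℂ → ℂ} (hd : DifferentiableOn ℂ ω {z | 0 < z.im})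
    (hω : ∀ z, 0 < z.im → z.im ≤ (ω z).im) :
    ∃ C : ℝ, ∀ y : ℝ, 1 ≤ y → ‖ω (I * y)‖ ≤ C * y := by
  have hI : 0 < I.im := by simp
  refine ⟨4 * (ω I).im + 2 * ‖ω I‖, fun y hy => ?_⟩
  have hy0 : 0 < y := by linarith
  have hyI : 0 < (I * (y : ℂ)).im := by simpa using hy0
  have h := schwarzPick_im (c := 0) hd (fun z hz => hz.trans_le (hω z hz)) hI hyI
  have hn : ‖I * (y : ℂ) - I‖ = y - 1 := by
    rw [← mul_sub_one, norm_mul, norm_I, one_mul, ← ofReal_one, ← ofReal_sub, norm_real,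
      Real.norm_of_nonneg (by linarith)]
  rw [hn] at h
  simp only [I_mul_im, ofReal_re, I_im, mul_one, sub_zero] at h
  set a := ω (I * y)
  set k := (ω I).im
  have hk : 0 < k := hI.trans_le (hω I hI)
  have h1 : ‖a - ω I‖ ^ 2 ≤ y * a.im * k := by
    refine le_of_mul_le_mul_right (h.trans ?_) hy0
    have h2 : 0 ≤ a.im * k := mul_nonneg (hyI.le.trans (hω _ hyI)) hk.le
    nlinarith
  have h2 : a.im ≤ ‖a‖ := (le_abs_self _).trans (abs_im_le_norm a)
  have h3 : ‖a‖ - ‖ω I‖ ≤ ‖a - ω I‖ := norm_sub_norm_le _ _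
  have h4 : 0 ≤ ‖ω I‖ := norm_nonneg _
  by_contra! hlt
  have h5 : ‖ω I‖ ≤ ‖ω I‖ * y := by nlinarith
  have h6 : ‖a‖ / 2 < ‖a‖ - ‖ω I‖ := by nlinarith
  have h7 : ‖a‖ ^ 2 / 4 < y * ‖a‖ * k := by
    have : y * a.im * k ≤ y * ‖a‖ * k := by gcongr
    have h8 : 0 ≤ ‖a‖ / 2 := by positivity
    have : (‖a‖ / 2) ^ 2 < ‖a - ω I‖ ^ 2 := pow_lt_pow_left₀ (h6.trans_le h3) h8 two_ne_zero
    nlinarith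
  have h9 : 4 * k * y ≤ ‖a‖ := by
    have := mul_nonneg h4 hy0.le
    nlinarith
  nlinarith [mul_nonneg (norm_nonneg a) (sub_nonneg.2 h9)]

/-- The subordination functions solve the coupled fixed point equations. -/
lemma exists_subordination_functions (μ ν : Measure ℝ) [IsProbabilityMeasure μ]
    [IsProbabilityMeasure ν] :
    ∃ ω₁ ω₂ : ℂ → ℂ,
      DifferentiableOn ℂ ω₁ {z | 0 < z.im} ∧ DifferentiableOn ℂ ω₂ {z | 0 < z.im} ∧
      (∀ z, 0 < z.im → z.im ≤ (ω₁ z).im) ∧ (∀ z, 0 < z.im → z.im ≤ (ω₂ z).im) ∧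
      (∀ z, 0 < z.im → reciprocalCauchySub μ (ω₁ z) = ω₂ z - z) ∧
      ∀ z, 0 < z.im → reciprocalCauchySub ν (ω₂ z) = ω₁ z - z := by
  choose! ω hω hfix using fun (z : ℂ) (hz : 0 < z.im) => exists_subordination_point μ ν hz
  have hd₁ := differentiableOn_reciprocalCauchySub μ
  have hi₁ := fun (z : ℂ) (hz : 0 < z.im) => im_reciprocalCauchySub_nonneg μ hz
  have hi₂ := fun (z : ℂ) (hz : 0 < z.im) => im_reciprocalCauchySub_nonneg ν hz
  have hωd := differentiableOn_of_fixedPoint hd₁ (differentiableOn_reciprocalCauchySub ν)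
    hi₁ hi₂ hω hfix
  have him₂ := fun (z : ℂ) (hz : 0 < z.im) => im_le_im_add hi₁ z (hω z hz)
  refine ⟨ω, fun z => z + reciprocalCauchySub μ (ω z), hωd,
    differentiableOn_id.add (hd₁.comp hωd hω), fun z hz => ?_, him₂,
    fun z _ => (add_sub_cancel_left _ _).symm, fun z hz => ?_⟩
  · rw [← hfix z hz]
    exact im_le_im_add hi₂ z (hz.trans_le (him₂ z hz))
  · exact eq_sub_of_add_eq' (hfix z hz)

lemma tendsto_mul_cauchyTransform_subordination (μ ν : Measure ℝ) [IsProbabilityMeasure μ]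
    [IsProbabilityMeasure ν] {ω₁ ω₂ : ℂ → ℂ} (hd₁ : DifferentiableOn ℂ ω₁ {z | 0 < z.im})
    (hd₂ : DifferentiableOn ℂ ω₂ {z | 0 < z.im}) (him₁ : ∀ z, 0 < z.im → z.im ≤ (ω₁ z).im)
    (him₂ : ∀ z, 0 < z.im → z.im ≤ (ω₂ z).im)
    (hν : ∀ z, 0 < z.im → reciprocalCauchySub ν (ω₂ z) = ω₁ z - z) :
    Tendsto (fun y : ℝ => I * y * cauchyTransform μ (ω₁ (I * y))) atTop (𝓝 1) := by
  have hev : ∀ {ω : ℂ → ℂ}, (∀ z, 0 < z.im → z.im ≤ (ω z).im) → ∀ᶠ y : ℝ in atTop,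
      y ≤ (ω (I * y)).im := fun {ω} h => by
    filter_upwards [eventually_gt_atTop 0] with y hy
    simpa using h (I * y) (by simpa using hy)
  have hstolz : ∀ {ω : ℂ → ℂ} {C : ℝ}, (∀ z, 0 < z.im → z.im ≤ (ω z).im) →
      (∀ y : ℝ, 1 ≤ y → ‖ω (I * y)‖ ≤ C * y) →
      ∀ᶠ y : ℝ in atTop, ‖ω (I * y)‖ ≤ C * (ω (I * y)).im := fun {ω} {C} h hC => by
    filter_upwards [eventually_ge_atTop 1, hev h] with y hy hy'
    have hC0 : 0 ≤ C := by
      have := (norm_nonneg _).trans (hC y hy)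
      nlinarith
    exact (hC y hy).trans (by gcongr)
  obtain ⟨C₁, hC₁⟩ := exists_norm_le_im hd₁ him₁
  obtain ⟨C₂, hC₂⟩ := exists_norm_le_im hd₂ him₂
  have h1 : Tendsto (fun y : ℝ => ω₁ (I * y) * cauchyTransform μ (ω₁ (I * y))) atTop (𝓝 1) :=
    tendsto_mul_cauchyTransform μ (tendsto_atTop_mono' _ (hev him₁) tendsto_id) (hstolz him₁ hC₁)
  have h2 : Tendsto (fun y : ℝ => reciprocalCauchySub ν (ω₂ (I * y)) / ω₂ (I * y)) atTop (𝓝 0) :=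
    tendsto_reciprocalCauchySub_div ν (tendsto_atTop_mono' _ (hev him₂) tendsto_id)
      (hstolz him₂ hC₂)
  have h3 : Tendsto (fun y : ℝ => reciprocalCauchySub ν (ω₂ (I * y)) / (I * y)) atTop (𝓝 0) := by
    have hb : Tendsto (fun y : ℝ => C₂ * ‖reciprocalCauchySub ν (ω₂ (I * y)) / ω₂ (I * y)‖) atTop
        (𝓝 0) := by simpa using h2.norm.const_mul C₂
    refine squeeze_zero_norm' ?_ hb
    filter_upwards [eventually_ge_atTop 1] with y hy
    have hy0 : 0 < y := by linarith
    have hω0 : 0 < ‖ω₂ (I * y)‖ := by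
      have h := him₂ (I * y) (by simpa using hy0)
      have h' := (le_abs_self _).trans (abs_im_le_norm (ω₂ (I * y)))
      simp only [I_mul_im, ofReal_re] at h
      linarith
    rw [norm_div, norm_div, norm_mul, norm_I, one_mul, norm_real, Real.norm_of_nonneg hy0.le,
      mul_div_assoc', div_le_div_iff₀ hy0 hω0]
    have := mul_le_mul_of_nonneg_left (hC₂ y hy) (norm_nonneg (reciprocalCauchySub ν (ω₂ (I * y))))
    linarith
  have h4 : Tendsto (fun y : ℝ => (reciprocalCauchySub ν (ω₂ (I * y)) / (I * y) + 1)⁻¹) atTop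
      (𝓝 1) := by
    simpa using (h3.add_const 1).inv₀ (by simp)
  have h5 := h4.mul h1
  rw [one_mul] at h5
  refine h5.congr' ?_
  filter_upwards [eventually_gt_atTop 0] with y hy
  have hpos : 0 < (I * (y : ℂ)).im := by simpa using hy
  have hne : I * (y : ℂ) ≠ 0 := fun h => by simp [h] at hpos
  have hne' : ω₁ (I * y) ≠ 0 := fun h => by
    have := him₁ _ hpos
    rw [h, zero_im] at this
    linarith
  rw [hν _ hpos, sub_div, div_self hne, sub_add_cancel, inv_div, div_mul_eq_mul_div,
    mul_left_comm, mul_div_cancel_left₀ _ hne']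

end Subordination

section Herglotz

noncomputable instance : MeasurableSpace Circle := borel Circle

instance : BorelSpace Circle := ⟨rfl⟩

/-- The measure on the circle with density `q` with respect to the normalised arc length. -/
noncomputable def circleDensity (q : Circle → ℝ) : Measure Circle :=
  ((volume.restrict (Ioc 0 (2 * Real.pi))).withDensity
    fun θ => ENNReal.ofReal ((2 * Real.pi)⁻¹ * q (Circle.exp θ))).map Circle.exp

lemma isFiniteMeasure_circleDensity {q : Circle → ℝ} (hq : Continuous q) :
    IsFiniteMeasure (circleDensity q) := by
  have hi : Integrable (fun θ : ℝ => (2 * Real.pi)⁻¹ * q (Circle.exp θ))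
      (volume.restrict (Ioc 0 (2 * Real.pi))) :=
    ((continuous_const.mul (hq.comp Circle.exp.continuous)).integrableOn_Ioc)
  have := isFiniteMeasure_withDensity_ofReal hi.2
  unfold circleDensity
  infer_instance

lemma integral_circleDensity {q : Circle → ℝ} (hq : Continuous q) (hq0 : ∀ e, 0 ≤ q e)
    {f : Circle → ℝ} (hf : Continuous f) :
    ∫ e, f e ∂(circleDensity q) =
      (2 * Real.pi)⁻¹ * ∫ θ in 0..2 * Real.pi, q (Circle.exp θ) * f (Circle.exp θ) := by
  have hexp : Measurable Circle.exp := Circle.exp.continuous.measurable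
  have hdens : Measurable fun θ : ℝ => ENNReal.ofReal ((2 * Real.pi)⁻¹ * q (Circle.exp θ)) :=
    (measurable_const.mul (hq.measurable.comp hexp)).ennreal_ofReal
  rw [circleDensity, integral_map hexp.aemeasurable hf.aestronglyMeasurable,
    integral_withDensity_eq_integral_toReal_smul hdens
      (Eventually.of_forall fun _ => ENNReal.ofReal_lt_top),
    intervalIntegral.integral_of_le Real.two_pi_pos.le, ← integral_const_mul]
  refine integral_congr_ae (Eventually.of_forall fun θ => ?_)
  have h0 : 0 ≤ (2 * Real.pi)⁻¹ * q (Circle.exp θ) :=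
    mul_nonneg (inv_nonneg.2 Real.two_pi_pos.le) (hq0 _)
  simp only [ENNReal.toReal_ofReal h0, smul_eq_mul, mul_assoc]

lemma continuous_poisson_circle {w : ℂ} (hw : ‖w‖ < 1) :
    Continuous fun e : Circle => (1 - ‖w‖ ^ 2) / ‖(e : ℂ) - w‖ ^ 2 := by
  refine continuous_const.div (by fun_prop) fun e h => ?_
  have : (e : ℂ) = w := by simpa [sub_eq_zero] using h
  rw [← this, Circle.norm_coe] at hw
  exact lt_irrefl _ hw

lemma integral_poisson_circleDensity {p : ℂ → ℂ} (hp : DiffContOnCl ℂ p (ball 0 1))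
    (hpc : Continuous fun e : Circle => (p e).re) (hre : ∀ e : Circle, 0 ≤ (p e).re) {w : ℂ}
    (hw : ‖w‖ < 1) :
    ∫ e : Circle, (1 - ‖w‖ ^ 2) / ‖(e : ℂ) - w‖ ^ 2 ∂(circleDensity fun e => (p e).re) =
      (p w).re := by
  rw [integral_circleDensity hpc hre (continuous_poisson_circle hw),
    ← hp.circleAverage_poissonKernel_smul' (mem_ball_zero_iff.2 hw), Real.circleAverage_def,
    smul_re, smul_eq_mul]
  have hcm : ∀ θ : ℝ, circleMap 0 1 θ = (Circle.exp θ : ℂ) := fun θ => by simp [circleMap]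
  have hpcm : Continuous fun θ : ℝ => p (Circle.exp θ) :=
    hp.continuousOn.comp_continuous (by fun_prop) fun θ => by
      simp [closure_ball]
  have hci : Continuous fun θ : ℝ =>
      ((1 - ‖w‖ ^ 2) / ‖(Circle.exp θ : ℂ) - w‖ ^ 2) • p (Circle.exp θ) :=
    ((continuous_poisson_circle hw).comp Circle.exp.continuous).smul hpcm
  simp only [hcm, sub_zero, Circle.norm_coe, one_pow]
  rw [← reCLM_apply, ← reCLM.intervalIntegral_comp_comm (hci.intervalIntegrable _ _)]
  simp only [reCLM_apply, smul_re, smul_eq_mul, mul_comm]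

/-- **Herglotz's theorem**: a holomorphic function on the unit disk with nonnegative real part
is the Poisson integral of a finite measure on the circle, up to an imaginary constant. -/
lemma exists_poisson_measure {p : ℂ → ℂ} (hp : DifferentiableOn ℂ p (ball 0 1))
    (hre : ∀ w ∈ ball (0 : ℂ) 1, 0 ≤ (p w).re) :
    ∃ σ : Measure Circle, IsFiniteMeasure σ ∧ ∀ w : ℂ, ‖w‖ < 1 →
      ∫ e : Circle, (1 - ‖w‖ ^ 2) / ‖(e : ℂ) - w‖ ^ 2 ∂σ = (p w).re := by
  let r : ℕ → ℝ := fun n => 1 - 1 / ((n : ℝ) + 1 + 1)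
  have hr0 : ∀ n, 0 ≤ r n := fun n => by
    simp only [r, sub_nonneg]
    rw [div_le_one (by positivity)]
    have : (0 : ℝ) ≤ n := n.cast_nonneg
    linarith
  have hr1 : ∀ n, r n < 1 := fun n => sub_lt_self _ (by positivity)
  have hrlim : Tendsto r atTop (𝓝 1) := by
    have := ((tendsto_add_atTop_iff_nat 1).2
      (tendsto_one_div_add_atTop_nhds_zero_nat (𝕜 := ℝ))).const_sub 1
    simpa [r] using this
  have hmem : ∀ n, ∀ w : ℂ, ‖w‖ ≤ 1 → (r n : ℂ) * w ∈ ball (0 : ℂ) 1 := fun n w hw => by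
    rw [mem_ball_zero_iff, norm_mul, norm_real, Real.norm_of_nonneg (hr0 n)]
    nlinarith [hr0 n, hr1 n, norm_nonneg w]
  have hmaps : ∀ n, MapsTo (fun w : ℂ => (r n : ℂ) * w) (closedBall 0 1) (ball 0 1) :=
    fun n w hw => hmem n w (mem_closedBall_zero_iff.1 hw)
  have hdc : ∀ n, DiffContOnCl ℂ (fun w => p (r n * w)) (ball 0 1) := fun n => by
    refine DifferentiableOn.diffContOnCl ?_
    rw [closure_ball _ one_ne_zero]
    exact hp.comp (differentiableOn_id.const_mul _) (hmaps n)
  have hpc : ∀ n, Continuous fun e : Circle => (p (r n * e)).re := fun n =>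
    continuous_re.comp (hp.continuousOn.comp_continuous (by fun_prop)
      fun e => hmem n e (Circle.norm_coe e).le)
  have hpn : ∀ n, ∀ e : Circle, 0 ≤ (p (r n * e)).re :=
    fun n e => hre _ (hmem n e (Circle.norm_coe e).le)
  let σ : ℕ → FiniteMeasure Circle := fun n =>
    ⟨circleDensity fun e => (p (r n * e)).re, isFiniteMeasure_circleDensity (hpc n)⟩
  have hσ : ∀ n, ∀ w : ℂ, ‖w‖ < 1 →
      ∫ e : Circle, (1 - ‖w‖ ^ 2) / ‖(e : ℂ) - w‖ ^ 2 ∂(σ n : Measure Circle) = (p (r n * w)).re :=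
    fun n w hw => integral_poisson_circleDensity (hdc n) (hpc n) (hpn n) hw
  have hmass : ∀ n, (σ n).mass ≤ Real.toNNReal (p 0).re := fun n => by
    have h := hσ n 0 (by simp)
    simp only [norm_zero, ne_eq, OfNat.ofNat_ne_zero, not_false_eq_true, zero_pow, sub_zero,
      Circle.norm_coe, one_pow, div_one, integral_const, smul_eq_mul, mul_one, mul_zero] at h
    rw [← h]
    exact (Real.toNNReal_coe (r := (σ n).mass)).ge
  obtain ⟨τ, -, hτ⟩ := (isCompact_setOfPred_finiteMeasure_le_of_compactSpace Circle
    (Real.toNNReal (p 0).re)).ultrafilter_le_nhds ((hyperfilter ℕ).map σ)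
    (le_principal_iff.2 (mem_map.2 (univ_mem' hmass)))
  have hlim : Tendsto σ (hyperfilter ℕ : Filter ℕ) (𝓝 τ) := hτ
  refine ⟨τ, inferInstance, fun w hw => ?_⟩
  have h1 := FiniteMeasure.tendsto_iff_forall_integral_tendsto.1 hlim
    (BoundedContinuousFunction.mkOfCompact ⟨_, continuous_poisson_circle hw⟩)
  simp only [BoundedContinuousFunction.mkOfCompact_apply, ContinuousMap.coe_mk] at h1
  refine tendsto_nhds_unique h1 ?_
  simp only [hσ _ w hw]
  have hcont : ContinuousAt (fun s : ℝ => (p (s * w)).re) 1 := by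
    have hc : ContinuousAt p ((1 : ℝ) * w) := by
      rw [ofReal_one, one_mul]
      exact (hp.differentiableAt (isOpen_ball.mem_nhds (mem_ball_zero_iff.2 hw))).continuousAt
    exact continuous_re.continuousAt.comp (ContinuousAt.comp (f := fun s : ℝ => (s : ℂ) * w) hc
      (by fun_prop))
  have h2 := hcont.tendsto.comp (hrlim.mono_left Nat.hyperfilter_le_atTop)
  simpa using! h2

end Herglotz

section Representation

/-- The boundary values on the circle of the inverse Cayley transform. -/
noncomputable def circleToReal (e : Circle) : ℝ := (I * (1 + e) / (1 - e)).re

lemma measurable_coe_circle : Measurable fun e : Circle => (e : ℂ) :=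
  Continuous.measurable (by fun_prop)

lemma measurable_circleToReal : Measurable circleToReal := by
  unfold circleToReal
  have := measurable_coe_circle
  fun_prop

lemma one_sub_coe_circle_ne_zero {e : Circle} (he : e ≠ 1) : (1 : ℂ) - e ≠ 0 := by
  rw [sub_ne_zero]
  exact fun h => he (Circle.ext (by simpa using h.symm))

lemma ofReal_circleToReal {e : Circle} (he : e ≠ 1) :
    (circleToReal e : ℂ) = I * (1 + e) / (1 - e) := by
  refine conj_eq_iff_re.1 ?_
  have h0 := one_sub_coe_circle_ne_zero he
  have h1 : (e : ℂ) ≠ 0 := Circle.coe_ne_zero e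
  have h2 : (e : ℂ) - 1 ≠ 0 := by rwa [← neg_sub, neg_ne_zero]
  have h3 : (1 : ℂ) - (e : ℂ)⁻¹ ≠ 0 := by
    rw [← div_self h1, ← one_div, ← sub_div]
    exact div_ne_zero h2 h1
  simp only [map_div₀, map_mul, map_add, map_sub, conj_I, map_one, ← Circle.coe_inv_eq_conj,
    Circle.coe_inv]
  rw [div_eq_div_iff h3 h0]
  field_simp
  ring

lemma add_I_ne_zero {z : ℂ} (hz : 0 < z.im) : z + I ≠ 0 := fun h => by
  have := congrArg im h
  simp at this
  linarith

/-- The Poisson kernel of the disk in the half-plane coordinate. -/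
lemma poisson_cayley {z : ℂ} (hz : 0 < z.im) (e : Circle) :
    (1 - ‖(z - I) / (z + I)‖ ^ 2) / ‖(e : ℂ) - (z - I) / (z + I)‖ ^ 2 =
      4 * z.im / ‖(e : ℂ) * (z + I) - (z - I)‖ ^ 2 := by
  have h0 := add_I_ne_zero hz
  have h1 : ‖z + I‖ ^ 2 ≠ 0 := pow_ne_zero _ (norm_ne_zero_iff.2 h0)
  have h2 : (e : ℂ) - (z - I) / (z + I) = (e * (z + I) - (z - I)) / (z + I) := by
    field_simp
  have h3 : ‖z + I‖ ^ 2 - ‖z - I‖ ^ 2 = 4 * z.im := by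
    rw [← normSq_eq_norm_sq, ← normSq_eq_norm_sq, normSq_apply, normSq_apply]
    simp
    ring
  rw [h2, norm_div, norm_div, div_pow, div_pow, one_sub_div h1, h3, div_div_div_cancel_right₀ h1]

lemma poisson_cayley_one {z : ℂ} (hz : 0 < z.im) :
    (1 - ‖(z - I) / (z + I)‖ ^ 2) / ‖((1 : Circle) : ℂ) - (z - I) / (z + I)‖ ^ 2 = z.im := by
  rw [poisson_cayley hz]
  have : ((1 : Circle) : ℂ) * (z + I) - (z - I) = 2 * I := by
    rw [Circle.coe_one]
    ring
  rw [this, norm_mul, norm_I]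
  norm_num

lemma poisson_cayley_of_ne {z : ℂ} (hz : 0 < z.im) {e : Circle} (he : e ≠ 1) :
    (1 - ‖(z - I) / (z + I)‖ ^ 2) / ‖(e : ℂ) - (z - I) / (z + I)‖ ^ 2 =
      4 / ‖(1 : ℂ) - e‖ ^ 2 * (z.im * ‖(z - circleToReal e)⁻¹‖ ^ 2) := by
  have h0 := one_sub_coe_circle_ne_zero he
  have h1 : (e : ℂ) * (z + I) - (z - I) = -((1 - e) * (z - circleToReal e)) := by
    rw [ofReal_circleToReal he]
    field_simp
    ring
  rw [poisson_cayley hz, h1, norm_neg, norm_mul, norm_inv]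
  field_simp

/-- The Nevanlinna representation of the imaginary part of a holomorphic function from the upper
half-plane to the closed lower half-plane. -/
lemma exists_lintegral_eq_neg_im {G : ℂ → ℂ} (hd : DifferentiableOn ℂ G {z | 0 < z.im})
    (him : ∀ z, 0 < z.im → (G z).im ≤ 0) :
    ∃ (b : ENNReal) (ρ : Measure ℝ), ∀ z : ℂ, 0 < z.im → ENNReal.ofReal (-(G z).im) =
      ENNReal.ofReal z.im * b + ∫⁻ t, ENNReal.ofReal (z.im * ‖(z - (t : ℂ))⁻¹‖ ^ 2) ∂ρ := by
  have hmaps : ∀ w ∈ ball (0 : ℂ) 1, 0 < (I * (1 + w) / (1 - w)).im := fun w hw => by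
    have h := im_cayley_symm_pos (a := I) (by simp) (mem_ball_zero_iff.1 hw)
    rwa [conj_I, neg_mul, sub_neg_eq_add, ← mul_one_add] at h
  have hpd : DifferentiableOn ℂ (fun w => I * G (I * (1 + w) / (1 - w))) (ball 0 1) := by
    refine (hd.comp ?_ hmaps).const_mul I
    refine DifferentiableOn.div (by fun_prop) (by fun_prop) fun w hw h => ?_
    rw [mem_ball_zero_iff, ← sub_eq_zero.1 h, norm_one] at hw
    exact lt_irrefl _ hw
  obtain ⟨σ, hσ, hrep⟩ := exists_poisson_measure hpd fun w hw => by
    simpa using him _ (hmaps w hw)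
  have hdens : Measurable fun e : Circle => ENNReal.ofReal (4 / ‖(1 : ℂ) - e‖ ^ 2) := by
    have := measurable_coe_circle
    fun_prop
  refine ⟨σ {1}, ((σ.restrict {1}ᶜ).withDensity fun e => ENNReal.ofReal (4 / ‖(1 : ℂ) - e‖ ^ 2)).map
    circleToReal, fun z hz => ?_⟩
  have hw : ‖(z - I) / (z + I)‖ < 1 := by simpa using norm_cayley_lt_one hz (b := I) (by simp)
  have hpos : ∀ e : Circle,
      0 ≤ (1 - ‖(z - I) / (z + I)‖ ^ 2) / ‖(e : ℂ) - (z - I) / (z + I)‖ ^ 2 := fun e => by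
    rw [poisson_cayley hz]
    positivity
  have hz' : I * (1 + (z - I) / (z + I)) / (1 - (z - I) / (z + I)) = z := by
    have h0 := add_I_ne_zero hz
    have h1 : 1 + (z - I) / (z + I) = 2 * z / (z + I) := by
      field_simp
      ring
    have h2 : 1 - (z - I) / (z + I) = 2 * I / (z + I) := by
      field_simp
      ring
    rw [h1, h2]
    field_simp
  have hcont := continuous_poisson_circle hw
  have h1 := hrep _ hw
  simp only [hz', I_mul_re] at h1
  rw [← h1, ofReal_integral_eq_lintegral_ofReal
    (hcont.integrable_of_hasCompactSupport (HasCompactSupport.of_compactSpace _))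
    (Eventually.of_forall hpos), ← lintegral_add_compl _ (measurableSet_singleton (1 : Circle)),
    lintegral_singleton, poisson_cayley_one hz]
  congr 1
  have hker : Measurable fun t : ℝ => ENNReal.ofReal (z.im * ‖(z - (t : ℂ))⁻¹‖ ^ 2) := by fun_prop
  rw [lintegral_map hker measurable_circleToReal]
  refine Eq.trans ?_ (lintegral_withDensity_eq_lintegral_mul _ hdens
    (hker.comp measurable_circleToReal)).symm
  refine setLIntegral_congr_fun (measurableSet_singleton (1 : Circle)).compl fun e he => ?_
  simp only [Pi.mul_apply, Function.comp]
  rw [poisson_cayley_of_ne hz he, ENNReal.ofReal_mul (by positivity)]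

lemma norm_sq_I_mul_sub (y t : ℝ) : ‖I * (y : ℂ) - t‖ ^ 2 = y ^ 2 + t ^ 2 := by
  rw [← normSq_eq_norm_sq, normSq_apply]
  simp
  ring

/-- A holomorphic function from the upper half-plane to the closed lower half-plane which is
asymptotic to `1 / z` along the imaginary axis is the Cauchy transform of a probability measure. -/
theorem exists_cauchyTransform_eq {G : ℂ → ℂ} (hd : DifferentiableOn ℂ G {z | 0 < z.im})
    (him : ∀ z, 0 < z.im → (G z).im ≤ 0)
    (hlim : Tendsto (fun y : ℝ => I * y * G (I * y)) atTop (𝓝 1)) :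
    ∃ ρ : Measure ℝ, IsProbabilityMeasure ρ ∧ ∀ z, 0 < z.im → cauchyTransform ρ z = G z := by
  obtain ⟨b, ρ, hρ⟩ := exists_lintegral_eq_neg_im hd him
  have hpos : ∀ {y : ℝ}, 0 < y → 0 < (I * (y : ℂ)).im := fun hy => by simpa using hy
  have hlim' : Tendsto (fun y : ℝ => y * -(G (I * y)).im) atTop (𝓝 1) := by
    have h := (continuous_re.tendsto _).comp hlim
    simp only [one_re] at h
    refine h.congr fun y => ?_
    simp [mul_assoc]
  have hb : b = 0 := by
    have h1 : Tendsto (fun y : ℝ => ENNReal.ofReal (y * -(G (I * y)).im / y ^ 2)) atTop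
        (𝓝 (ENNReal.ofReal 0)) :=
      ENNReal.tendsto_ofReal (hlim'.div_atTop (tendsto_pow_atTop two_ne_zero))
    rw [ENNReal.ofReal_zero] at h1
    refine nonpos_iff_eq_zero.1 (ge_of_tendsto h1 ?_)
    filter_upwards [eventually_gt_atTop 0] with y hy
    have h2 := hρ _ (hpos hy)
    simp only [I_mul_im, ofReal_re] at h2
    have h3 : y * -(G (I * y)).im / y ^ 2 = -(G (I * y)).im / y := by
      field_simp
    rw [h3, ENNReal.ofReal_div_of_pos hy, ENNReal.le_div_iff_mul_le
      (Or.inl (by simpa using hy)) (Or.inl ENNReal.ofReal_ne_top), mul_comm, h2]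
    exact le_self_add
  simp only [hb, mul_zero, zero_add] at hρ
  have hmass : ρ univ = 1 := by
    have hnat : Tendsto (fun n : ℕ => (n : ℝ) + 1) atTop atTop :=
      tendsto_atTop_add_const_right _ _ tendsto_natCast_atTop_atTop
    have h1 : Tendsto (fun n : ℕ => ∫⁻ t, ENNReal.ofReal (((n : ℝ) + 1) ^ 2 /
        (((n : ℝ) + 1) ^ 2 + t ^ 2)) ∂ρ) atTop (𝓝 (∫⁻ _, 1 ∂ρ)) := by
      refine lintegral_tendsto_of_tendsto_of_monotone (fun n => by fun_prop)
        (Eventually.of_forall fun t m n hmn => ENNReal.ofReal_le_ofReal ?_)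
        (Eventually.of_forall fun t => ?_)
      · rw [div_le_div_iff₀ (by positivity) (by positivity)]
        have : ((m : ℝ) + 1) ^ 2 ≤ ((n : ℝ) + 1) ^ 2 := by gcongr
        nlinarith [sq_nonneg t]
      · rw [← ENNReal.ofReal_one]
        refine ENNReal.tendsto_ofReal ?_
        have h2 : Tendsto (fun s : ℝ => 1 - t ^ 2 / (s ^ 2 + t ^ 2)) atTop (𝓝 1) := by
          simpa using (tendsto_const_nhds.div_atTop (tendsto_atTop_add_const_right _ (t ^ 2)
            (tendsto_pow_atTop (α := ℝ) two_ne_zero)) (a := t ^ 2)).const_sub 1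
        refine (h2.comp hnat).congr fun n => ?_
        simp only [Function.comp]
        have : ((n : ℝ) + 1) ^ 2 + t ^ 2 ≠ 0 := by positivity
        field_simp
        ring
    have h2 := ENNReal.tendsto_ofReal (hlim'.comp hnat)
    rw [ENNReal.ofReal_one] at h2
    rw [lintegral_one] at h1
    refine tendsto_nhds_unique h1 (h2.congr fun n => ?_)
    have hn : (0 : ℝ) < n + 1 := by positivity
    simp only [Function.comp]
    rw [ENNReal.ofReal_mul hn.le, hρ _ (hpos hn), ← lintegral_const_mul _ (by fun_prop)]
    refine lintegral_congr fun t => ?_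
    rw [← ENNReal.ofReal_mul hn.le, norm_inv, inv_pow, norm_sq_I_mul_sub]
    simp only [I_mul_im, ofReal_re]
    congr 1
    ring
  have hprob : IsProbabilityMeasure ρ := ⟨hmass⟩
  have himeq : ∀ z, 0 < z.im → (G z - cauchyTransform ρ z).im = 0 := fun z hz => by
    have h1 := congrArg ENNReal.toReal (hρ z hz)
    rw [ENNReal.toReal_ofReal (neg_nonneg.2 (him z hz)), ← integral_eq_lintegral_of_nonneg_ae
      (Eventually.of_forall fun t => by positivity) (by fun_prop), integral_const_mul] at h1
    rw [sub_im, im_cauchyTransform ρ hz, ← h1]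
    ring
  have hconv : IsConnected {z : ℂ | 0 < z.im} :=
    ⟨⟨I, by simp⟩, (convex_halfSpace_im_gt 0).isPreconnected⟩
  obtain ⟨c, hc⟩ := AnalyticOnNhd.eq_const_of_im_eq_const
    ((hd.sub (differentiableOn_cauchyTransform ρ)).analyticOnNhd isOpen_upperHalfPlane) himeq
    isOpen_upperHalfPlane hconv
  refine ⟨ρ, hprob, fun z hz => ?_⟩
  have hGρ : Tendsto (fun y : ℝ => I * y * cauchyTransform ρ (I * y)) atTop (𝓝 1) :=
    tendsto_mul_cauchyTransform (C := 1) ρ (by simpa using! tendsto_id) (by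
      filter_upwards [eventually_gt_atTop 0] with y hy
      simp [abs_of_pos hy])
  have hzero : Tendsto (fun y : ℝ => I * y * c) atTop (𝓝 0) := by
    have h := hlim.sub hGρ
    rw [sub_self] at h
    refine h.congr' ?_
    filter_upwards [eventually_gt_atTop 0] with y hy
    rw [← mul_sub, ← hc _ (hpos hy)]
    rfl
  have hc0 : c = 0 := by
    have h1 : Tendsto (fun y : ℝ => (y : ℂ)⁻¹) atTop (𝓝 0) := by
      have h := (continuous_ofReal.tendsto 0).comp tendsto_inv_atTop_zero
      rw [ofReal_zero] at h
      exact h.congr fun y => ofReal_inv y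
    have h2 := h1.mul hzero
    rw [zero_mul] at h2
    have h3 : I * c = 0 := by
      refine tendsto_nhds_unique (tendsto_const_nhds.congr' ?_) h2
      filter_upwards [eventually_gt_atTop 0] with y hy
      have : (y : ℂ) ≠ 0 := by exact_mod_cast hy.ne'
      field_simp
    simpa using h3
  have h := hc z hz
  rw [hc0] at h
  exact (sub_eq_zero.1 h).symm

end Representation

/-- Subordination for free convolution.  For Borel probability
measures `μ, ν` on `ℝ` there are holomorphic self-maps `ω₁, ω₂` of the upper
half-plane such that `G_μ(ω₁(z)) = G_ν(ω₂(z))` and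
`ω₁(z) + ω₂(z) − 1/G_μ(ω₁(z)) = z` on `ℂ⁺`, and a Borel probability measure `ρ`
(the free convolution `μ ⊞ ν`) with `G_ρ(z) = G_μ(ω₁(z))` on `ℂ⁺`. -/
theorem subordination_free_convolution
    (μ ν : Measure ℝ) [IsProbabilityMeasure μ] [IsProbabilityMeasure ν] :
    ∃ ω₁ ω₂ : ℂ → ℂ,
      DifferentiableOn ℂ ω₁ {z : ℂ | 0 < z.im} ∧
      DifferentiableOn ℂ ω₂ {z : ℂ | 0 < z.im} ∧
      (∀ z : ℂ, 0 < z.im → 0 < (ω₁ z).im) ∧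
      (∀ z : ℂ, 0 < z.im → 0 < (ω₂ z).im) ∧
      (∀ z : ℂ, 0 < z.im →
        cauchyTransform μ (ω₁ z) = cauchyTransform ν (ω₂ z)) ∧
      (∀ z : ℂ, 0 < z.im →
        ω₁ z + ω₂ z - (cauchyTransform μ (ω₁ z))⁻¹ = z) ∧
      ∃ ρ : Measure ℝ, IsProbabilityMeasure ρ ∧
        ∀ z : ℂ, 0 < z.im → cauchyTransform ρ z = cauchyTransform μ (ω₁ z) := by
  obtain ⟨ω₁, ω₂, hd₁, hd₂, him₁, him₂, hμ, hν⟩ := exists_subordination_functions μ ν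
  have hpos₁ : ∀ z : ℂ, 0 < z.im → 0 < (ω₁ z).im := fun z hz => hz.trans_le (him₁ z hz)
  have hF : ∀ z : ℂ, 0 < z.im → (cauchyTransform μ (ω₁ z))⁻¹ = ω₁ z + ω₂ z - z := fun z hz => by
    have h := hμ z hz
    rw [reciprocalCauchySub] at h
    linear_combination h
  have hF' : ∀ z : ℂ, 0 < z.im → (cauchyTransform ν (ω₂ z))⁻¹ = ω₁ z + ω₂ z - z := fun z hz => by
    have h := hν z hz
    rw [reciprocalCauchySub] at h
    linear_combination h
  refine ⟨ω₁, ω₂, hd₁, hd₂, hpos₁, fun z hz => hz.trans_le (him₂ z hz),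
    fun z hz => inv_injective ((hF z hz).trans (hF' z hz).symm),
    fun z hz => by rw [hF z hz, sub_sub_cancel], ?_⟩
  exact exists_cauchyTransform_eq ((differentiableOn_cauchyTransform μ).comp hd₁ hpos₁)
    (fun z hz => (im_cauchyTransform_neg μ (hpos₁ z hz)).le)
    (tendsto_mul_cauchyTransform_subordination μ ν hd₁ hd₂ him₁ him₂ hν)
end

section
/- Stieltjes inversion formula: Let ν be a Borel probability measure on ℝ with Cauchy transform G_ν. Then for all real numbers a < b, −(1/π) · lim_{τ → 0⁺} ∫_a^b Im G_ν(t + iτ) dt = ν((a, b)) + (1/2)(ν({a}) + ν({b})). -/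
open MeasureTheory

/-- The imaginary part of the Cauchy kernel is minus the (unnormalised) Poisson kernel. -/
lemma im_cauchy_kernel (t τ x : ℝ) :
    (((t : ℂ) + τ * Complex.I - (x : ℂ))⁻¹).im = -(τ / ((t - x) ^ 2 + τ ^ 2)) := by
  rw [Complex.inv_im]
  simp [Complex.normSq_apply]
  ring

lemma poisson_kernel_denom_pos {τ : ℝ} (hτ : 0 < τ) (t x : ℝ) : 0 < (t - x) ^ 2 + τ ^ 2 := by
  positivity

lemma continuous_cauchy_kernel {τ : ℝ} (hτ : 0 < τ) (t : ℝ) :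
    Continuous fun x : ℝ => ((t : ℂ) + τ * Complex.I - (x : ℂ))⁻¹ := by
  refine Continuous.inv₀ (by fun_prop) fun x h => hτ.ne' ?_
  simpa using congrArg Complex.im h

lemma norm_cauchy_kernel_le {τ : ℝ} (hτ : 0 < τ) (t x : ℝ) :
    ‖((t : ℂ) + τ * Complex.I - (x : ℂ))⁻¹‖ ≤ τ⁻¹ := by
  rw [norm_inv]
  refine inv_anti₀ hτ ?_
  have h := Complex.abs_im_le_norm ((t : ℂ) + τ * Complex.I - (x : ℂ))
  simpa [abs_of_pos hτ] using h

lemma im_cauchyTransform_s10 (ν : Measure ℝ) [IsFiniteMeasure ν] {τ : ℝ} (hτ : 0 < τ) (t : ℝ) :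
    (cauchyTransform ν ((t : ℂ) + τ * Complex.I)).im
      = -∫ x, τ / ((t - x) ^ 2 + τ ^ 2) ∂ν := by
  have hint : Integrable (fun x : ℝ => ((t : ℂ) + τ * Complex.I - (x : ℂ))⁻¹) ν :=
    Integrable.of_bound (continuous_cauchy_kernel hτ t).aestronglyMeasurable τ⁻¹
      (.of_forall (norm_cauchy_kernel_le hτ t))
  have h := integral_im hint
  simp only [RCLike.im_to_complex, im_cauchy_kernel, integral_neg] at h
  exact h.symm

lemma integral_poisson_kernel {τ : ℝ} (hτ : 0 < τ) (a b x : ℝ) :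
    ∫ t in a..b, τ / ((t - x) ^ 2 + τ ^ 2)
      = Real.arctan ((b - x) / τ) - Real.arctan ((a - x) / τ) := by
  refine intervalIntegral.integral_eq_sub_of_hasDerivAt (f := fun t => Real.arctan ((t - x) / τ))
    (fun t _ => ?_) (Continuous.intervalIntegrable ?_ a b)
  · refine (((hasDerivAt_id' t).sub_const x).div_const τ).arctan.congr_deriv ?_
    have := (poisson_kernel_denom_pos hτ t x).ne'
    have : 1 + ((t - x) / τ) ^ 2 ≠ 0 := by positivity
    field_simp
    ring
  · exact Continuous.div (by fun_prop) (by fun_prop)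
      fun t => (poisson_kernel_denom_pos hτ t x).ne'

lemma integrable_poisson_kernel_prod (ν : Measure ℝ) [IsFiniteMeasure ν] {τ : ℝ} (hτ : 0 < τ)
    (a b : ℝ) :
    Integrable (Function.uncurry fun t x : ℝ => τ / ((t - x) ^ 2 + τ ^ 2))
      ((volume.restrict (Set.Ioc a b)).prod ν) := by
  refine Integrable.of_bound (C := τ⁻¹) (Continuous.aestronglyMeasurable ?_)
    (.of_forall fun p => ?_)
  · exact Continuous.div (by fun_prop) (by fun_prop)
      fun p => (poisson_kernel_denom_pos hτ p.1 p.2).ne'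
  · have h := (Complex.abs_im_le_norm _).trans (norm_cauchy_kernel_le hτ p.1 p.2)
    rwa [im_cauchy_kernel, abs_neg] at h

lemma integral_im_cauchyTransform (ν : Measure ℝ) [IsFiniteMeasure ν] {τ : ℝ} (hτ : 0 < τ)
    {a b : ℝ} (hab : a ≤ b) :
    ∫ t in a..b, (cauchyTransform ν ((t : ℂ) + τ * Complex.I)).im
      = -∫ x, (Real.arctan ((b - x) / τ) - Real.arctan ((a - x) / τ)) ∂ν := by
  simp only [im_cauchyTransform_s10 ν hτ,
    ← integral_poisson_kernel hτ a b, intervalIntegral.integral_of_le hab, integral_neg]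
  rw [integral_integral_swap (integrable_poisson_kernel_prod ν hτ a b)]

lemma tendsto_arctan_div_nhdsGT_zero (c : ℝ) :
    Filter.Tendsto (fun τ : ℝ => Real.arctan (c / τ)) (nhdsWithin 0 (Set.Ioi 0))
      (nhds (Real.pi / 2 * SignType.sign c)) := by
  rcases lt_trichotomy c 0 with hc | rfl | hc
  · have h := (Real.tendsto_arctan_atBot.mono_right nhdsWithin_le_nhds).comp
      (tendsto_inv_nhdsGT_zero.const_mul_atTop_of_neg hc)
    simpa [sign_neg hc, Function.comp_def, div_eq_mul_inv] using h
  · simp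
  · have h := (Real.tendsto_arctan_atTop.mono_right nhdsWithin_le_nhds).comp
      (tendsto_inv_nhdsGT_zero.const_mul_atTop hc)
    simpa [sign_pos hc, Function.comp_def, div_eq_mul_inv] using h

lemma sign_sub_sign_eq_indicator {a b : ℝ} (hab : a < b) (x : ℝ) :
    Real.pi / 2 * (SignType.sign (b - x) : ℝ) - Real.pi / 2 * (SignType.sign (a - x) : ℝ)
      = (Set.Ioo a b).indicator (fun _ => Real.pi) x
        + (({a} : Set ℝ).indicator (fun _ => Real.pi / 2) x
          + ({b} : Set ℝ).indicator (fun _ => Real.pi / 2) x) := by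
  rcases lt_trichotomy x a with ha | rfl | ha
  · have hb := ha.trans hab
    simp [sign_pos (sub_pos.2 ha), sign_pos (sub_pos.2 hb), ha.ne, hb.ne, ha.not_gt]
  · simp [sign_pos (sub_pos.2 hab), hab.ne]
  · rcases lt_trichotomy x b with hb | rfl | hb
    · simp [sign_neg (sub_neg.2 ha), sign_pos (sub_pos.2 hb), ha, hb, ha.ne', hb.ne]
    · simp [sign_neg (sub_neg.2 ha), ha.ne']
    · simp [sign_neg (sub_neg.2 ha), sign_neg (sub_neg.2 hb), ha.ne', hb.ne', hb.not_gt]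

lemma integral_sign_sub_sign (ν : Measure ℝ) [IsFiniteMeasure ν] {a b : ℝ} (hab : a < b) :
    ∫ x, (Real.pi / 2 * (SignType.sign (b - x) : ℝ)
        - Real.pi / 2 * (SignType.sign (a - x) : ℝ)) ∂ν
      = Real.pi * ((ν (Set.Ioo a b)).toReal + (1 / 2) * ((ν {a}).toReal + (ν {b}).toReal)) := by
  simp only [sign_sub_sign_eq_indicator hab]
  have hi {s : Set ℝ} (hs : MeasurableSet s) (c : ℝ) : Integrable (s.indicator fun _ => c) ν :=
    (integrable_const c).indicator hs
  have ha := hi (measurableSet_singleton a) (Real.pi / 2)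
  have hb := hi (measurableSet_singleton b) (Real.pi / 2)
  have hadd : Integrable (fun x => ({a} : Set ℝ).indicator (fun _ => Real.pi / 2) x
      + ({b} : Set ℝ).indicator (fun _ => Real.pi / 2) x) ν := ha.add hb
  rw [integral_add (hi measurableSet_Ioo _) hadd, integral_add ha hb,
    integral_indicator_const _ measurableSet_Ioo,
    integral_indicator_const _ (measurableSet_singleton a),
    integral_indicator_const _ (measurableSet_singleton b)]
  simp only [Measure.real, smul_eq_mul]
  ring

/-- Stieltjes inversion formula.  For a Borel probability measure
`ν` on `ℝ` and reals `a < b`,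
`−(1/π) lim_{τ→0⁺} ∫_a^b Im G_ν(t + iτ) dt = ν((a,b)) + (ν({a}) + ν({b}))/2`. -/
theorem stieltjes_inversion
    (ν : Measure ℝ) [IsProbabilityMeasure ν] (a b : ℝ) (hab : a < b) :
    Filter.Tendsto
      (fun τ : ℝ =>
        -(1 / Real.pi) * ∫ t in a..b, (cauchyTransform ν ((t : ℂ) + τ * Complex.I)).im)
      (nhdsWithin 0 (Set.Ioi 0))
      (nhds ((ν (Set.Ioo a b)).toReal + (1 / 2) * ((ν {a}).toReal + (ν {b}).toReal))) := by
  have hlim : Filter.Tendsto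
      (fun τ : ℝ => ∫ x, (Real.arctan ((b - x) / τ) - Real.arctan ((a - x) / τ)) ∂ν)
      (nhdsWithin 0 (Set.Ioi 0))
      (nhds (∫ x, (Real.pi / 2 * (SignType.sign (b - x) : ℝ)
        - Real.pi / 2 * (SignType.sign (a - x) : ℝ)) ∂ν)) := by
    refine tendsto_integral_filter_of_dominated_convergence (fun _ => Real.pi)
      (.of_forall fun τ => Measurable.aestronglyMeasurable (by fun_prop))
      (.of_forall fun τ => .of_forall fun x => ?_) (integrable_const _)
      (.of_forall fun x => (tendsto_arctan_div_nhdsGT_zero _).sub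
        (tendsto_arctan_div_nhdsGT_zero _))
    rw [Real.norm_eq_abs, abs_le]
    constructor <;>
      linarith [Real.arctan_lt_pi_div_two ((b - x) / τ), Real.arctan_lt_pi_div_two ((a - x) / τ),
        Real.neg_pi_div_two_lt_arctan ((b - x) / τ), Real.neg_pi_div_two_lt_arctan ((a - x) / τ)]
  rw [integral_sign_sub_sign ν hab] at hlim
  have h := hlim.const_mul Real.pi⁻¹
  rw [inv_mul_cancel_left₀ Real.pi_ne_zero] at h
  refine h.congr' ?_
  filter_upwards [self_mem_nhdsWithin] with τ hτ
  rw [integral_im_cauchyTransform ν hτ hab.le, one_div, neg_mul_neg]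
end

section
/- Cauchy transforms determine measures: If ν_1 and ν_2 are Borel probability measures on ℝ whose Cauchy transforms agree on the upper half-plane, i.e., G_{ν_1}(z) = G_{ν_2}(z) for all z ∈ ℂ⁺, then ν_1 = ν_2. -/
open MeasureTheory

namespace CauchyTransform

open ProbabilityTheory
open scoped Topology NNReal ENNReal Real

lemma integrable_inv_sub (ν : Measure ℝ) [IsFiniteMeasure ν] {z : ℂ} (hz : 0 < z.im) :
    Integrable (fun t : ℝ ↦ (z - (t : ℂ))⁻¹) ν := by
  refine Integrable.of_bound (C := z.im⁻¹) (by fun_prop) (ae_of_all _ fun t ↦ ?_)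
  rw [norm_inv]
  gcongr
  simpa [abs_of_pos hz] using Complex.abs_im_le_norm (z - t)

lemma cauchyPDFReal_zero_sub_eq (γ : ℝ≥0) (x t : ℝ) :
    cauchyPDFReal 0 γ (x - t) = -π⁻¹ * (((x + γ * Complex.I : ℂ) - t)⁻¹).im := by
  simp [cauchyPDFReal_def, Complex.inv_im, Complex.normSq_apply]
  ring

lemma integrable_cauchyPDFReal_zero_sub (ν : Measure ℝ) [IsFiniteMeasure ν] {γ : ℝ≥0}
    (hγ : 0 < γ) (x : ℝ) : Integrable (fun t ↦ cauchyPDFReal 0 γ (x - t)) ν := by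
  simp_rw [cauchyPDFReal_zero_sub_eq]
  exact (integrable_inv_sub ν (by simpa using hγ)).im.const_mul _

/-- The Poisson integral of a measure is read off from its Cauchy transform. -/
lemma lintegral_cauchyPDF_zero_sub (ν : Measure ℝ) [IsFiniteMeasure ν] {γ : ℝ≥0}
    (hγ : 0 < γ) (x : ℝ) :
    ∫⁻ t, cauchyPDF 0 γ (x - t) ∂ν =
      ENNReal.ofReal (-π⁻¹ * (cauchyTransform ν (x + γ * Complex.I)).im) := by
  simp_rw [cauchyPDF_def]
  rw [← ofReal_integral_eq_lintegral_ofReal (integrable_cauchyPDFReal_zero_sub ν hγ x)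
    (ae_of_all _ fun t ↦ (cauchyPDF_pos 0 hγ.ne' _).le)]
  simp_rw [cauchyPDFReal_zero_sub_eq]
  rw [integral_const_mul, cauchyTransform]
  congr 2
  exact integral_im (integrable_inv_sub ν (by simpa using hγ))

/-- Convolving a measure with an absolutely continuous one gives a measure with density. -/
lemma conv_withDensity (ν : Measure ℝ) [SFinite ν] {g : ℝ → ℝ≥0∞} (hg : Measurable g) :
    ν.conv (volume.withDensity g) = volume.withDensity fun x ↦ ∫⁻ t, g (x - t) ∂ν := by
  refine Measure.ext_of_lintegral _ fun f hf ↦ ?_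
  have hm : Measurable fun p : ℝ × ℝ ↦ g (p.1 - p.2) := by fun_prop
  rw [Measure.lintegral_conv hf,
    lintegral_withDensity_eq_lintegral_mul _ hm.lintegral_prod_right' hf]
  calc ∫⁻ t, ∫⁻ y, f (t + y) ∂(volume.withDensity g) ∂ν
    _ = ∫⁻ t, (∫⁻ x, g (x - t) * f x) ∂ν := by
      refine lintegral_congr fun t ↦ ?_
      rw [lintegral_withDensity_eq_lintegral_mul _ hg (by fun_prop),
        ← lintegral_sub_right_eq_self _ t]
      simp
    _ = ∫⁻ x, ∫⁻ t, g (x - t) * f x ∂ν := lintegral_lintegral_swap (by fun_prop)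
    _ = _ := lintegral_congr fun x ↦ lintegral_mul_const _ (by fun_prop)

lemma conv_cauchyMeasure (ν : Measure ℝ) [IsFiniteMeasure ν] {γ : ℝ≥0} (hγ : 0 < γ) :
    ν.conv (cauchyMeasure 0 γ) = volume.withDensity fun x : ℝ ↦
      ENNReal.ofReal (-π⁻¹ * (cauchyTransform ν (x + γ * Complex.I)).im) := by
  rw [cauchyMeasure_of_scale_ne_zero _ hγ.ne', conv_withDensity ν (by fun_prop)]
  simp_rw [lintegral_cauchyPDF_zero_sub ν hγ]

lemma charFun_cauchyMeasure_eq_integral {γ : ℝ≥0} (hγ : γ ≠ 0) (t : ℝ) :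
    charFun (cauchyMeasure 0 γ) t =
      ∫ x, cauchyPDFReal 0 γ x • Complex.exp (t * x * Complex.I) := by
  rw [charFun_apply_real, cauchyMeasure_of_scale_ne_zero _ hγ]
  unfold cauchyPDF
  rw [integral_withDensity_eq_integral_toReal_smul (by fun_prop) (by simp)]
  simp_rw [ENNReal.toReal_ofReal (cauchyPDF_pos 0 hγ _).le]

lemma charFun_cauchyMeasure_scale {γ : ℝ≥0} (hγ : 0 < γ) (t : ℝ) :
    charFun (cauchyMeasure 0 γ) t = charFun (cauchyMeasure 0 1) (γ * t) := by
  rw [charFun_cauchyMeasure_eq_integral hγ.ne', charFun_cauchyMeasure_eq_integral one_ne_zero]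
  have hγ' : (0 : ℝ) < γ := hγ
  have key := Measure.integral_comp_mul_left
    (fun x : ℝ ↦ cauchyPDFReal 0 γ x • Complex.exp (t * x * Complex.I)) (γ : ℝ)
  rw [abs_of_pos (by positivity), eq_inv_smul_iff₀ hγ'.ne'] at key
  rw [← key, ← integral_smul]
  refine integral_congr_ae (ae_of_all _ fun x ↦ ?_)
  have hdens : γ * cauchyPDFReal 0 γ (γ * x) = cauchyPDFReal 0 1 x := by
    simp only [cauchyPDFReal_def, NNReal.coe_one]
    field_simp
    ring
  simp only [smul_smul, hdens]
  push_cast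
  ring_nf

lemma exists_charFun_cauchyMeasure_ne_zero (t : ℝ) :
    ∃ γ : ℝ≥0, 0 < γ ∧ charFun (cauchyMeasure 0 γ) t ≠ 0 := by
  have hc : Continuous fun γ : ℝ≥0 ↦ charFun (cauchyMeasure 0 1) (γ * t) :=
    continuous_charFun.comp (by fun_prop)
  have h0 : charFun (cauchyMeasure 0 1) (((0 : ℝ≥0) : ℝ) * t) ≠ 0 := by simp
  have hne : ∀ᶠ γ : ℝ≥0 in 𝓝[>] 0, charFun (cauchyMeasure 0 1) (γ * t) ≠ 0 :=
    (hc.continuousAt.eventually_ne h0).filter_mono nhdsWithin_le_nhds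
  obtain ⟨γ, hγ, hpos⟩ := (hne.and self_mem_nhdsWithin).exists
  exact ⟨γ, hpos, by rwa [charFun_cauchyMeasure_scale hpos]⟩

end CauchyTransform

/-- Cauchy transforms determine measures.  If two Borel
probability measures on `ℝ` have the same Cauchy transform on the upper
half-plane, they are equal. -/
theorem cauchyTransform_injective
    (ν₁ ν₂ : Measure ℝ) [IsProbabilityMeasure ν₁] [IsProbabilityMeasure ν₂]
    (h : ∀ z : ℂ, 0 < z.im → cauchyTransform ν₁ z = cauchyTransform ν₂ z) :
    ν₁ = ν₂ := by
  refine Measure.ext_of_charFun (funext fun t ↦ ?_)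
  obtain ⟨γ, hγ, hne⟩ := CauchyTransform.exists_charFun_cauchyMeasure_ne_zero t
  have hconv : ν₁.conv (ProbabilityTheory.cauchyMeasure 0 γ) =
      ν₂.conv (ProbabilityTheory.cauchyMeasure 0 γ) := by
    rw [CauchyTransform.conv_cauchyMeasure ν₁ hγ, CauchyTransform.conv_cauchyMeasure ν₂ hγ]
    congr with x
    rw [h _ (by simpa using hγ)]
  have hmul := congrArg (charFun · t) hconv
  simp only [charFun_conv] at hmul
  exact mul_right_cancel₀ hne hmul
end

section
/- Asymptotic freeness under random rotation: Let (A_N)_N and (B_N)_N be sequences of deterministic N×N complex matrices with sup_N ‖A_N‖ < ∞ and sup_N ‖B_N‖ < ∞ (operator norm), such that α_m = lim_{N→∞} tr(A_N^m) and β_m = lim_{N→∞} tr(B_N^m) exist for every m ≥ 0, and let U_N be Haar-distributed N×N unitary random matrices. Then there exist a noncommutative probability space (A, φ) and free elements a, b ∈ A with φ(a^m) = α_m and φ(b^m) = β_m for all m, such that for every m ≥ 1 and all nonnegative integers p_1, q_1, …, p_m, q_m, lim_{N→∞} E[tr(A_N^{p_1} (U_N B_N U_N*)^{q_1} ⋯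 A_N^{p_m} (U_N B_N U_N*)^{q_m})] = φ(a^{p_1} b^{q_1} ⋯ a^{p_m} b^{q_m}). -/
open scoped Classical

/-- A noncommutative probability space: a unital associative `ℂ`-algebra `A`
together with a `ℂ`-linear functional `φ : A → ℂ` with `φ(1) = 1`. -/
structure NCProbSpace where
  A : Type
  [ringA : Ring A]
  [algA : Algebra ℂ A]
  phi : A → ℂ
  phi_add : ∀ x y : A, phi (x + y) = phi x + phi y
  phi_smul : ∀ (c : ℂ) (x : A), phi (c • x) = c * phi x
  phi_one : phi (1 : A) = 1

attribute [instance] NCProbSpace.ringA NCProbSpace.algA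

/-- Freeness of a family of elements `x : ι → A` in a noncommutative
probability space: for any `m ≥ 2`, any polynomials `p_1, …, p_m` over `ℂ`, and
any indices `i_1, …, i_m` with consecutive indices distinct, if
`φ(p_k(x_{i_k})) = 0` for all `k`, then `φ(p_1(x_{i_1}) ⋯ p_m(x_{i_m})) = 0`. -/
def IsFreeFamily (P : NCProbSpace) {ι : Type*} (x : ι → P.A) : Prop :=
  ∀ (m : ℕ), 2 ≤ m → ∀ (i : Fin m → ι) (p : Fin m → Polynomial ℂ),
    (∀ (k : ℕ) (h : k + 1 < m), i ⟨k, Nat.lt_of_succ_lt h⟩ ≠ i ⟨k + 1, h⟩) →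
    (∀ k : Fin m, P.phi (Polynomial.aeval (x (i k)) (p k)) = 0) →
    P.phi ((List.ofFn (fun k => Polynomial.aeval (x (i k)) (p k))).prod) = 0

open MeasureTheory

noncomputable instance matrixMeasurableSpace {m n α : Type*} [MeasurableSpace α] :
    MeasurableSpace (Matrix m n α) :=
  (MeasurableSpace.pi : MeasurableSpace (m → n → α))

/-- `ν` is the law of an `N×N` Haar-distributed unitary random matrix: a Borel
probability measure on `N×N` complex matrices, carried by the unitary group,
and invariant under left translation by every unitary matrix (on the compact
group `U(N)` this characterizes the Haar probability measure). -/
def IsHaarUnitaryLaw (N : ℕ) (ν : Measure (Matrix (Fin N) (Fin N) ℂ)) : Prop :=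
  IsProbabilityMeasure ν ∧
  ν {U | U ∈ Matrix.unitaryGroup (Fin N) ℂ} = 1 ∧
  ∀ V ∈ Matrix.unitaryGroup (Fin N) ℂ, ν.map (fun U => V * U) = ν

namespace RandomRotation

open scoped Matrix.Norms.L2Operator Topology
open Filter

abbrev Mat (N : ℕ) := Matrix (Fin N) (Fin N) ℂ

section Haar

variable {N : ℕ}

instance : BorelSpace (Mat N) := inferInstanceAs (BorelSpace (Fin N → Fin N → ℂ))

instance : SecondCountableTopology (Mat N) :=
  inferInstanceAs (SecondCountableTopology (Fin N → Fin N → ℂ))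

theorem norm_le_one_of_mem_unitaryGroup {U : Mat N} (hU : U ∈ Matrix.unitaryGroup (Fin N) ℂ) :
    ‖U‖ ≤ 1 := by
  rcases subsingleton_or_nontrivial (Mat N) with h | h
  · simp [Subsingleton.elim U 0]
  · exact (CStarRing.norm_of_mem_unitary hU).le

theorem isCompact_unitaryGroup :
    IsCompact {U : Mat N | U ∈ Matrix.unitaryGroup (Fin N) ℂ} := by
  have : ProperSpace (Mat N) := FiniteDimensional.proper ℂ _
  refine Metric.isCompact_of_isClosed_isBounded ?_ ?_
  · have : {U : Mat N | U ∈ Matrix.unitaryGroup (Fin N) ℂ} = {U | U * star U = 1} := by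
      ext U; exact Matrix.mem_unitaryGroup_iff
    rw [this]
    exact isClosed_eq (by fun_prop) continuous_const
  · refine (Metric.isBounded_iff_subset_closedBall 0).2 ⟨1, fun U hU => ?_⟩
    exact mem_closedBall_zero_iff.2 (norm_le_one_of_mem_unitaryGroup hU)

theorem exists_bound_unitary {E : Type*} [NormedAddCommGroup E] {f : Mat N → E}
    (hf : Continuous f) : ∃ C : ℝ, ∀ U ∈ Matrix.unitaryGroup (Fin N) ℂ, ‖f U‖ ≤ C :=
  isCompact_unitaryGroup.exists_bound_of_continuousOn hf.continuousOn

theorem ae_mem_unitaryGroup {ν : Measure (Mat N)} (hν : IsHaarUnitaryLaw N ν) :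
    ∀ᵐ U ∂ν, U ∈ Matrix.unitaryGroup (Fin N) ℂ := by
  have := hν.1
  refine (mem_ae_iff_prob_eq_one ?_).2 hν.2.1
  exact isCompact_unitaryGroup.measurableSet

theorem integrable_of_continuous {ν : Measure (Mat N)} (hν : IsHaarUnitaryLaw N ν)
    {f : Mat N → ℂ} (hf : Continuous f) : Integrable f ν := by
  have := hν.1
  obtain ⟨C, hC⟩ := exists_bound_unitary hf
  exact Integrable.of_bound hf.aestronglyMeasurable C
    ((ae_mem_unitaryGroup hν).mono hC)

theorem integral_mul_left {ν : Measure (Mat N)} (hν : IsHaarUnitaryLaw N ν)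
    {f : Mat N → ℂ} (hf : Continuous f) {V : Mat N} (hV : V ∈ Matrix.unitaryGroup (Fin N) ℂ) :
    ∫ U, f (V * U) ∂ν = ∫ U, f U ∂ν := by
  have hm : Measurable fun U : Mat N => V * U :=
    (continuous_const.mul continuous_id).measurable
  conv_rhs => rw [← hν.2.2 V hV]
  rw [integral_map hm.aemeasurable hf.aestronglyMeasurable]

theorem exp_smul_mem_unitaryGroup {X : Mat N} (hX : X ∈ skewAdjoint (Mat N)) (t : ℝ) :
    NormedSpace.exp (t • X) ∈ Matrix.unitaryGroup (Fin N) ℂ :=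
  letI := NormedAlgebra.restrictScalars ℚ ℂ (Mat N)
  NormedSpace.exp_mem_unitary_of_mem_skewAdjoint (skewAdjoint.smul_mem t hX)

/-- `D X U` is the derivative at `t = 0` of `f (exp (t X) U)`, for every skew-adjoint `X`. -/
def HasLeftDeriv {E : Type*} [NormedAddCommGroup E] [NormedSpace ℝ E]
    (f : Mat N → E) (D : Mat N → Mat N → E) : Prop :=
  ∀ X ∈ skewAdjoint (Mat N), ∀ U, ∀ t : ℝ,
    HasDerivAt (fun s : ℝ => f (NormedSpace.exp (s • X) * U))
      (D X (NormedSpace.exp (t • X) * U)) t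

theorem HasLeftDeriv.integral_eq_zero {ν : Measure (Mat N)} (hν : IsHaarUnitaryLaw N ν)
    {f : Mat N → ℂ} {D : Mat N → Mat N → ℂ} (h : HasLeftDeriv f D) (hf : Continuous f)
    {X : Mat N} (hX : X ∈ skewAdjoint (Mat N)) (hD : Continuous (D X)) :
    ∫ U, D X U ∂ν = 0 := by
  have := hν.1
  obtain ⟨C, hC⟩ := exists_bound_unitary hD
  have key := hasDerivAt_integral_of_dominated_loc_of_deriv_le (μ := ν) (s := Set.univ)
    (F := fun (s : ℝ) U => f (NormedSpace.exp (s • X) * U))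
    (F' := fun (s : ℝ) U => D X (NormedSpace.exp (s • X) * U)) (x₀ := 0) (bound := fun _ => C)
    univ_mem
    (.of_forall fun s => (hf.comp (continuous_const.mul continuous_id)).aestronglyMeasurable)
    (integrable_of_continuous hν (hf.comp (continuous_const.mul continuous_id)))
    (hD.comp (continuous_const.mul continuous_id)).aestronglyMeasurable
    ((ae_mem_unitaryGroup hν).mono fun U hU s _ =>
      hC _ (mul_mem (exp_smul_mem_unitaryGroup hX s) hU))
    (integrable_const _) (.of_forall fun U s _ => h X hX U s)
  have h2 := key.2
  simp only [fun s : ℝ => integral_mul_left hν hf (exp_smul_mem_unitaryGroup hX s)] at h2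
  have h3 := h2.unique (hasDerivAt_const _ _)
  simpa using h3

end Haar

/-- The normalized trace. -/
noncomputable def ntr {N : ℕ} (M : Mat N) : ℂ := M.trace / N

theorem norm_apply_le {N : ℕ} (M : Mat N) (i j : Fin N) : ‖M i j‖ ≤ ‖M‖ := by
  have h := M.l2_opNorm_mulVec (EuclideanSpace.single j 1)
  rw [PiLp.norm_single, norm_one, mul_one] at h
  refine le_trans ?_ h
  refine le_trans (le_of_eq ?_) (PiLp.norm_apply_le _ i)
  simp

theorem norm_ntr_le {N : ℕ} (M : Mat N) : ‖ntr M‖ ≤ ‖M‖ := by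
  have h : ‖M.trace‖ ≤ N * ‖M‖ := by
    refine (norm_sum_le _ _).trans ?_
    refine (Finset.sum_le_sum fun i _ => norm_apply_le M i i).trans ?_
    simp
  rw [ntr, norm_div, Complex.norm_natCast]
  exact div_le_of_le_mul₀ (Nat.cast_nonneg _) (norm_nonneg _) (by linarith)

@[fun_prop]
theorem continuous_ntr {N : ℕ} : Continuous (ntr : Mat N → ℂ) :=
  (continuous_id.matrix_trace).div_const _

theorem ntr_add {N : ℕ} (M M' : Mat N) : ntr (M + M') = ntr M + ntr M' := by
  simp [ntr, add_div]

theorem ntr_sub {N : ℕ} (M M' : Mat N) : ntr (M - M') = ntr M - ntr M' := by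
  simp [ntr, sub_div]

theorem ntr_smul {N : ℕ} (c : ℂ) (M : Mat N) : ntr (c • M) = c * ntr M := by
  simp [ntr, mul_div_assoc]

theorem ntr_mul_comm {N : ℕ} (M M' : Mat N) : ntr (M * M') = ntr (M' * M) := by
  rw [ntr, Matrix.trace_mul_comm, ntr]

theorem ntr_mul_ntr_one {N : ℕ} (M : Mat N) : ntr M * ntr (1 : Mat N) = ntr M := by
  rcases Nat.eq_zero_or_pos N with rfl | h
  · simp [ntr]
  · have : (N : ℂ) ≠ 0 := by exact_mod_cast h.ne'
    simp [ntr, this]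

section Word

/-- A letter: index `0` marks a deterministic matrix sequence, index `1` a sequence that is
conjugated by the random unitary. -/
abbrev Letter := Fin 2 × ∀ N : ℕ, Mat N

variable {N : ℕ}

/-- Conjugation by `U` for the index `1`, no change for the index `0`. -/
def rot (c : Fin 2) (U P : Mat N) : Mat N := if c = 1 then U * P * U.conjTranspose else P

def word (U : Mat N) (w : List Letter) : Mat N := (w.map fun x => rot x.1 U (x.2 N)).prod

/-- The derivative of `word` under `U ↦ exp (t X) U`. -/
def wordDeriv (X U : Mat N) : List Letter → Mat N
  | [] => 0
  | x :: l =>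
    (if x.1 = 1 then X * rot x.1 U (x.2 N) - rot x.1 U (x.2 N) * X else 0) * word U l +
      rot x.1 U (x.2 N) * wordDeriv X U l

@[simp]
theorem word_nil (U : Mat N) : word U [] = 1 := rfl

theorem word_cons (U : Mat N) (x : Letter) (l : List Letter) :
    word U (x :: l) = rot x.1 U (x.2 N) * word U l := by
  simp [word]

theorem word_append (U : Mat N) (l l' : List Letter) :
    word U (l ++ l') = word U l * word U l' := by
  simp [word]

@[fun_prop]
theorem continuous_rot (c : Fin 2) (P : Mat N) : Continuous fun U : Mat N => rot c U P := by
  unfold rot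
  split_ifs <;> fun_prop

@[fun_prop]
theorem continuous_word (w : List Letter) : Continuous fun U : Mat N => word U w := by
  induction w with
  | nil => exact continuous_const
  | cons x l ih => simp only [word_cons]; fun_prop

@[fun_prop]
theorem continuous_wordDeriv (X : Mat N) (w : List Letter) :
    Continuous fun U : Mat N => wordDeriv X U w := by
  induction w with
  | nil => exact continuous_const
  | cons x l ih =>
    simp only [wordDeriv]
    split_ifs <;> fun_prop

theorem hasLeftDeriv_rot (c : Fin 2) (P : Mat N) :
    HasLeftDeriv (fun U : Mat N => rot c U P)
      (fun X U => if c = 1 then X * rot c U P - rot c U P * X else 0) := by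
  intro X hX U t
  by_cases hc : c = 1
  · simp only [rot, hc, if_true]
    have h1 : HasDerivAt (fun s : ℝ => NormedSpace.exp (s • X) * U)
        (X * NormedSpace.exp (t • X) * U) t := (hasDerivAt_exp_smul_const' X t).mul_const U
    have h2 : HasDerivAt (fun s : ℝ => star (NormedSpace.exp (s • X) * U))
        (star (X * NormedSpace.exp (t • X) * U)) t := h1.star
    have hX' : star X = -X := hX
    refine ((h1.mul_const P).mul h2).congr_deriv ?_
    simp only [star_mul, hX', Matrix.star_eq_conjTranspose, Matrix.conjTranspose_mul]
    noncomm_ring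
  · simp only [rot, hc, if_false]
    exact hasDerivAt_const _ _

theorem hasLeftDeriv_word (w : List Letter) :
    HasLeftDeriv (fun U : Mat N => word U w) (fun X U => wordDeriv X U w) := by
  induction w with
  | nil => exact fun X _ U t => hasDerivAt_const _ _
  | cons x l ih =>
    intro X hX U t
    simp only [word_cons, wordDeriv]
    exact (hasLeftDeriv_rot x.1 (x.2 N) X hX U t).mul (ih X hX U t)

theorem HasLeftDeriv.ntr_mul {f : Mat N → Mat N} {D : Mat N → Mat N → Mat N}
    (h : HasLeftDeriv f D) (Y : Mat N) :
    HasLeftDeriv (fun U => ntr (Y * f U)) (fun X U => ntr (Y * D X U)) := by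
  intro X hX U t
  let L : Mat N →ₗ[ℝ] ℂ :=
    { toFun := fun M => ntr (Y * M)
      map_add' := fun M M' => by rw [mul_add, ntr_add]
      map_smul' := fun c M => by simp [ntr, mul_div_assoc] }
  exact ((LinearMap.toContinuousLinearMap L).hasFDerivAt.comp_hasDerivAt t (h X hX U t))

theorem HasLeftDeriv.mul {f g : Mat N → ℂ} {D E : Mat N → Mat N → ℂ}
    (hf : HasLeftDeriv f D) (hg : HasLeftDeriv g E) :
    HasLeftDeriv (fun U => f U * g U) (fun X U => D X U * g U + f U * E X U) :=
  fun X hX U t => (hf X hX U t).mul (hg X hX U t)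

theorem wordDeriv_add (X X' U : Mat N) (w : List Letter) :
    wordDeriv (X + X') U w = wordDeriv X U w + wordDeriv X' U w := by
  induction w with
  | nil => simp [wordDeriv]
  | cons x l ih =>
    simp only [wordDeriv, ih]
    split_ifs <;> noncomm_ring

theorem wordDeriv_smul (c : ℂ) (X U : Mat N) (w : List Letter) :
    wordDeriv (c • X) U w = c • wordDeriv X U w := by
  induction w with
  | nil => simp [wordDeriv]
  | cons x l ih =>
    simp only [wordDeriv, ih]
    split_ifs <;> simp [smul_sub, sub_mul, smul_add]

/-- `splitSum U pre w` is the sum, over the conjugated letters `b` of `w`, of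
`tr(pre L) tr(b R) - tr(pre L b) tr(R)`, where `w = L b R`. -/
noncomputable def splitSum (U : Mat N) : List Letter → List Letter → ℂ
  | _, [] => 0
  | pre, x :: l =>
    (if x.1 = 1 then
      ntr (word U pre) * ntr (word U (x :: l)) - ntr (word U (pre ++ [x])) * ntr (word U l)
    else 0) + splitSum U (pre ++ [x]) l

theorem trace_single_mul_mul_single_mul (C D : Mat N) (i j : Fin N) :
    (Matrix.single j i (1 : ℂ) * (C * Matrix.single i j 1 * D)).trace = C i i * D j j := by
  rw [← Matrix.mul_assoc, ← Matrix.mul_assoc, Matrix.single_mul_mul_single,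
    Matrix.trace_single_mul]
  simp

theorem sum_ntr_single_mul_single (C D : Mat N) :
    (N : ℂ)⁻¹ * ∑ i, ∑ j, ntr (Matrix.single j i (1 : ℂ) * (C * Matrix.single i j 1 * D)) =
      ntr C * ntr D := by
  simp only [ntr, trace_single_mul_mul_single_mul, ← Finset.sum_div]
  rw [← Finset.sum_mul_sum]
  simp only [Matrix.trace, Matrix.diag]
  ring

theorem sum_ntr_single_mul_ntr_single (C D : Mat N) :
    (N : ℂ)⁻¹ * ∑ i, ∑ j, ntr (Matrix.single j i (1 : ℂ) * C) * ntr (Matrix.single i j 1 * D) =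
      ((N : ℂ)⁻¹) ^ 2 * ntr (C * D) := by
  simp only [ntr, Matrix.trace_single_mul, div_mul_div_comm, ← Finset.sum_div]
  simp only [Matrix.trace, Matrix.diag, Matrix.mul_apply, smul_eq_mul, one_mul]
  ring

theorem sum_ntr_single_mul_wordDeriv (U : Mat N) (pre w : List Letter) :
    (N : ℂ)⁻¹ * ∑ i, ∑ j, ntr (Matrix.single j i (1 : ℂ) *
      (word U pre * wordDeriv (Matrix.single i j 1) U w)) = splitSum U pre w := by
  induction w generalizing pre with
  | nil => simp [wordDeriv, splitSum, ntr]
  | cons x l ih =>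
    have hpre : word U (pre ++ [x]) = word U pre * rot x.1 U (x.2 N) := by
      simp [word]
    rw [splitSum, ← ih]
    by_cases hx : x.1 = 1
    · simp only [wordDeriv, if_pos hx]
      rw [word_cons, hpre, ← sum_ntr_single_mul_single, ← sum_ntr_single_mul_single,
        ← mul_sub, ← mul_add]
      simp only [← Finset.sum_sub_distrib, ← Finset.sum_add_distrib, ← ntr_add, ← ntr_sub]
      congr 1
      refine Finset.sum_congr rfl fun i _ => Finset.sum_congr rfl fun j _ => congrArg ntr ?_
      noncomm_ring
    · simp only [wordDeriv, if_neg hx, zero_mul, zero_add, hpre, mul_assoc]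

@[fun_prop]
theorem continuous_splitSum (pre w : List Letter) :
    Continuous fun U : Mat N => splitSum U pre w := by
  induction w generalizing pre with
  | nil => exact continuous_const
  | cons x l ih =>
    simp only [splitSum]
    have := ih (pre ++ [x])
    split_ifs <;> fun_prop

theorem integral_derivation_eq_zero {ν : Measure (Mat N)} (hν : IsHaarUnitaryLaw N ν)
    {T : Mat N → ℂ} {M : Mat N → Mat N} (hT : Continuous T) (hM : Continuous M)
    (hTM : HasLeftDeriv T fun X U => ntr (X * M U)) (w : List Letter) (X Y : Mat N) :
    ∫ U, (ntr (Y * wordDeriv X U w) * T U + ntr (Y * word U w) * ntr (X * M U)) ∂ν = 0 := by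
  have skew : ∀ X ∈ skewAdjoint (Mat N),
      ∫ U, (ntr (Y * wordDeriv X U w) * T U + ntr (Y * word U w) * ntr (X * M U)) ∂ν = 0 :=
    fun X hX => (((hasLeftDeriv_word w).ntr_mul Y).mul hTM).integral_eq_zero hν
      (by fun_prop) hX (by fun_prop)
  have hX : X = (1 / 2 : ℂ) • (X - star X) +
      (-Complex.I / 2) • (Complex.I • (X + star X)) := by
    rw [smul_smul, show -Complex.I / 2 * Complex.I = 1 / 2 by
      rw [div_mul_eq_mul_div, neg_mul, Complex.I_mul_I]; norm_num]
    rw [← smul_add, sub_add_add_cancel, ← two_smul ℂ, smul_smul]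
    norm_num
  have h1 := skew (X - star X) (by simp [skewAdjoint.mem_iff])
  have h2 := skew (Complex.I • (X + star X)) (by
    rw [skewAdjoint.mem_iff, star_smul, star_add, star_star]; simp [add_comm])
  rw [hX]
  generalize X - star X = X₁ at *
  generalize Complex.I • (X + star X) = X₂ at *
  have hint : ∀ X : Mat N, Integrable (fun U => ntr (Y * wordDeriv X U w) * T U +
      ntr (Y * word U w) * ntr (X * M U)) ν := fun X =>
    integrable_of_continuous hν (by fun_prop)
  calc
    _ = ∫ U, ((1 / 2 : ℂ) * (ntr (Y * wordDeriv X₁ U w) * T U + ntr (Y * word U w) *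
          ntr (X₁ * M U)) + (-Complex.I / 2) * (ntr (Y * wordDeriv X₂ U w) * T U +
          ntr (Y * word U w) * ntr (X₂ * M U))) ∂ν := by
      congr 1
      ext U
      simp only [wordDeriv_add, wordDeriv_smul, mul_add, add_mul, ntr_add, mul_smul_comm,
        smul_mul_assoc, ntr_smul]
      ring
    _ = 0 := by
      rw [integral_add ((hint X₁).const_mul _) ((hint X₂).const_mul _), integral_const_mul,
        integral_const_mul, h1, h2, mul_zero, mul_zero, add_zero]

theorem schwinger_dyson {ν : Measure (Mat N)} (hν : IsHaarUnitaryLaw N ν)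
    {T : Mat N → ℂ} {M : Mat N → Mat N} (hT : Continuous T) (hM : Continuous M)
    (hTM : HasLeftDeriv T fun X U => ntr (X * M U)) (w : List Letter) :
    ∫ U, splitSum U [] w * T U ∂ν = - (((N : ℂ)⁻¹) ^ 2 * ∫ U, ntr (word U w * M U) ∂ν) := by
  rw [eq_neg_iff_add_eq_zero, ← integral_const_mul, ← integral_add
    (integrable_of_continuous hν (by fun_prop)) (integrable_of_continuous hν (by fun_prop))]
  have h : ∀ U : Mat N, splitSum U [] w * T U + ((N : ℂ)⁻¹) ^ 2 * ntr (word U w * M U) =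
      (N : ℂ)⁻¹ * ∑ i, ∑ j, (ntr (Matrix.single j i 1 * wordDeriv (Matrix.single i j 1) U w) * T U +
        ntr (Matrix.single j i 1 * word U w) * ntr (Matrix.single i j 1 * M U)) := by
    intro U
    rw [← sum_ntr_single_mul_wordDeriv, ← sum_ntr_single_mul_ntr_single]
    simp only [Finset.sum_add_distrib, mul_add, word_nil, one_mul, mul_assoc, Finset.sum_mul]
  simp only [h]
  rw [integral_const_mul, integral_finsetSum _ fun i _ =>
    integrable_of_continuous hν (by fun_prop)]
  refine mul_eq_zero_of_right _ (Finset.sum_eq_zero fun i _ => ?_)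
  rw [integral_finsetSum _ fun j _ => integrable_of_continuous hν (by fun_prop)]
  exact Finset.sum_eq_zero fun j _ => integral_derivation_eq_zero hν hT hM hTM w _ _

end Word

section Bounds

variable {N : ℕ}

theorem norm_rot_le (c : Fin 2) {U : Mat N} (hU : U ∈ Matrix.unitaryGroup (Fin N) ℂ) (P : Mat N) :
    ‖rot c U P‖ ≤ ‖P‖ := by
  have h := norm_le_one_of_mem_unitaryGroup hU
  unfold rot
  split_ifs
  · calc ‖U * P * U.conjTranspose‖ ≤ ‖U‖ * ‖P‖ * ‖U.conjTranspose‖ :=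
          (norm_mul_le _ _).trans (by gcongr; exact norm_mul_le _ _)
      _ ≤ 1 * ‖P‖ * 1 := by rw [Matrix.l2_opNorm_conjTranspose]; gcongr
      _ = ‖P‖ := by ring
  · exact le_rfl

theorem rot_mul (c : Fin 2) {U : Mat N} (hU : U ∈ Matrix.unitaryGroup (Fin N) ℂ) (P Q : Mat N) :
    rot c U (P * Q) = rot c U P * rot c U Q := by
  have h : U.conjTranspose * U = 1 := Matrix.mem_unitaryGroup_iff'.1 hU
  unfold rot
  split_ifs
  · simp only [mul_assoc]
    rw [← mul_assoc U.conjTranspose U, h, one_mul]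
  · rfl

theorem rot_one (c : Fin 2) {U : Mat N} (hU : U ∈ Matrix.unitaryGroup (Fin N) ℂ) :
    rot c U 1 = 1 := by
  have h : U * U.conjTranspose = 1 := Matrix.mem_unitaryGroup_iff.1 hU
  unfold rot
  split_ifs <;> simp [h]

theorem rot_sub (c : Fin 2) (U P Q : Mat N) : rot c U (P - Q) = rot c U P - rot c U Q := by
  unfold rot
  split_ifs <;> noncomm_ring

theorem rot_smul (c : Fin 2) (U : Mat N) (k : ℂ) (P : Mat N) :
    rot c U (k • P) = k • rot c U P := by
  unfold rot
  split_ifs <;> simp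

theorem ntr_rot (c : Fin 2) {U : Mat N} (hU : U ∈ Matrix.unitaryGroup (Fin N) ℂ) (P : Mat N) :
    ntr (rot c U P) = ntr P := by
  have h : U.conjTranspose * U = 1 := Matrix.mem_unitaryGroup_iff'.1 hU
  unfold rot
  split_ifs
  · rw [ntr_mul_comm, ← mul_assoc, h, one_mul]
  · rfl

end Bounds

def UniformlyBounded (P : ∀ N, Mat N) : Prop := ∃ c : ℝ, ∀ N, ‖P N‖ ≤ c

theorem UniformlyBounded.mul {P Q : ∀ N, Mat N} (hP : UniformlyBounded P)
    (hQ : UniformlyBounded Q) : UniformlyBounded fun N => P N * Q N := by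
  obtain ⟨c, hc⟩ := hP
  obtain ⟨d, hd⟩ := hQ
  exact ⟨c * d, fun N => (norm_mul_le _ _).trans
    (mul_le_mul (hc N) (hd N) (norm_nonneg _) ((norm_nonneg _).trans (hc N)))⟩

theorem UniformlyBounded.add {P Q : ∀ N, Mat N} (hP : UniformlyBounded P)
    (hQ : UniformlyBounded Q) : UniformlyBounded fun N => P N + Q N := by
  obtain ⟨c, hc⟩ := hP
  obtain ⟨d, hd⟩ := hQ
  exact ⟨c + d, fun N => (norm_add_le _ _).trans (add_le_add (hc N) (hd N))⟩

theorem UniformlyBounded.smul_one {k : ℕ → ℂ} {c : ℝ} (hk : ∀ N, ‖k N‖ ≤ c) :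
    UniformlyBounded fun N => k N • (1 : Mat N) :=
  ⟨c, fun N => (norm_smul_le _ _).trans ((mul_le_mul (hk N)
    (norm_le_one_of_mem_unitaryGroup (one_mem _)) (norm_nonneg _)
    ((norm_nonneg _).trans (hk N))).trans_eq (mul_one c))⟩

theorem UniformlyBounded.center {P : ∀ N, Mat N} (hP : UniformlyBounded P) :
    UniformlyBounded fun N => P N - ntr (P N) • 1 := by
  obtain ⟨c, hc⟩ := id hP
  have := hP.add (UniformlyBounded.smul_one (k := fun N => -ntr (P N)) (c := c) fun N => by
    rw [norm_neg]; exact (norm_ntr_le _).trans (hc N))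
  simpa only [neg_smul, ← sub_eq_add_neg] using this

theorem exists_norm_word_le {w : List Letter} (hw : ∀ x ∈ w, UniformlyBounded x.2) :
    ∃ K : ℝ, ∀ N, ∀ U ∈ Matrix.unitaryGroup (Fin N) ℂ, ‖word U w‖ ≤ K := by
  induction w with
  | nil => exact ⟨1, fun N U _ => norm_le_one_of_mem_unitaryGroup (one_mem _)⟩
  | cons x l ih =>
    obtain ⟨K, hK⟩ := ih fun y hy => hw y (by simp [hy])
    obtain ⟨c, hc⟩ := hw x (by simp)
    refine ⟨c * K, fun N U hU => ?_⟩
    rw [word_cons]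
    exact (norm_mul_le _ _).trans (mul_le_mul ((norm_rot_le _ hU _).trans (hc N)) (hK N U hU)
      (norm_nonneg _) ((norm_nonneg _).trans (hc N)))

/-- The gradient of `U ↦ tr (C · word U w)` with `C` held fixed. -/
def wordGrad {N : ℕ} (U C : Mat N) : List Letter → Mat N
  | [] => 0
  | x :: l =>
    (if x.1 = 1 then rot x.1 U (x.2 N) * (word U l * C) - word U l * C * rot x.1 U (x.2 N)
      else 0) + wordGrad U (C * rot x.1 U (x.2 N)) l

theorem ntr_mul_wordDeriv {N : ℕ} (X U C : Mat N) (w : List Letter) :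
    ntr (C * wordDeriv X U w) = ntr (X * wordGrad U C w) := by
  induction w generalizing C with
  | nil => simp [wordDeriv, wordGrad, ntr]
  | cons x l ih =>
    rw [wordDeriv, wordGrad, mul_add, mul_add, ntr_add, ntr_add, ← mul_assoc C (rot _ _ _), ih]
    congr 1
    split_ifs
    · rw [sub_mul, mul_sub, mul_sub, ntr_sub, ntr_sub]
      congr 1
      · rw [ntr_mul_comm]
        simp only [mul_assoc]
      · rw [ntr_mul_comm]
        rw [show rot x.1 U (x.2 N) * X * word U l * C = rot x.1 U (x.2 N) *
          (X * (word U l * C)) by simp only [mul_assoc], ntr_mul_comm]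
        simp only [mul_assoc]
    · simp

theorem continuous_wordGrad {N : ℕ} (w : List Letter) {C : Mat N → Mat N} (hC : Continuous C) :
    Continuous fun U => wordGrad U (C U) w := by
  induction w generalizing C with
  | nil => exact continuous_const
  | cons x l ih =>
    simp only [wordGrad]
    have := ih (C := fun U => C U * rot x.1 U (x.2 N)) (by fun_prop)
    split_ifs <;> fun_prop

theorem exists_norm_wordGrad_le {w : List Letter} (hw : ∀ x ∈ w, UniformlyBounded x.2) :
    ∃ K : ℝ, ∀ N, ∀ U ∈ Matrix.unitaryGroup (Fin N) ℂ, ∀ C, ‖wordGrad U C w‖ ≤ K * ‖C‖ := by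
  induction w with
  | nil => exact ⟨0, fun N U _ C => by simp [wordGrad]⟩
  | cons x l ih =>
    obtain ⟨K, hK⟩ := ih fun y hy => hw y (by simp [hy])
    obtain ⟨W, hW⟩ := exists_norm_word_le (w := l) fun y hy => hw y (by simp [hy])
    obtain ⟨c, hc⟩ := hw x (by simp)
    have hK0 : 0 ≤ |K| := abs_nonneg K
    refine ⟨c * W + W * c + |K| * c, fun N U hU C => ?_⟩
    have hR : ‖rot x.1 U (x.2 N)‖ ≤ c := (norm_rot_le _ hU _).trans (hc N)
    have hc0 : 0 ≤ c := (norm_nonneg _).trans hR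
    have hW' := hW N U hU
    have hW0 : 0 ≤ W := (norm_nonneg _).trans hW'
    have h3 : ‖word U l * C‖ ≤ W * ‖C‖ := (norm_mul_le _ _).trans (by gcongr)
    have h1 : ‖rot x.1 U (x.2 N) * (word U l * C)‖ ≤ c * (W * ‖C‖) :=
      (norm_mul_le _ _).trans (by gcongr)
    have h2 : ‖word U l * C * rot x.1 U (x.2 N)‖ ≤ W * ‖C‖ * c :=
      (norm_mul_le _ _).trans (by gcongr)
    have h4 : ‖wordGrad U (C * rot x.1 U (x.2 N)) l‖ ≤ |K| * (‖C‖ * c) :=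
      (hK N U hU _).trans (mul_le_mul (le_abs_self K)
        ((norm_mul_le _ _).trans (by gcongr)) (norm_nonneg _) hK0)
    rw [wordGrad]
    refine (norm_add_le _ _).trans ?_
    have h5 : ‖(if x.1 = 1 then rot x.1 U (x.2 N) * (word U l * C) -
        word U l * C * rot x.1 U (x.2 N) else 0)‖ ≤ c * (W * ‖C‖) + W * ‖C‖ * c := by
      split_ifs
      · exact (norm_sub_le _ _).trans (add_le_add h1 h2)
      · rw [norm_zero]; positivity
    linarith

/-- Uniformly bounded smooth test functions of the unitary, with uniformly bounded gradient
(with respect to the normalized trace). -/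
def IsTest (T : ∀ N, Mat N → ℂ) : Prop :=
  ∃ (M : ∀ N, Mat N → Mat N) (C : ℝ), ∀ N, Continuous (T N) ∧ Continuous (M N) ∧
    (∀ U ∈ Matrix.unitaryGroup (Fin N) ℂ, ‖T N U‖ ≤ C ∧ ‖M N U‖ ≤ C) ∧
    HasLeftDeriv (T N) fun X U => ntr (X * M N U)

theorem IsTest.continuous {T : ∀ N, Mat N → ℂ} (hT : IsTest T) (N : ℕ) : Continuous (T N) := by
  obtain ⟨M, C, h⟩ := hT
  exact (h N).1

theorem isTest_one : IsTest fun _ _ => 1 :=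
  ⟨fun _ _ => 0, 1, fun N => ⟨continuous_const, continuous_const, by simp, fun X _ U t => by
    simpa [ntr] using hasDerivAt_const t (1 : ℂ)⟩⟩

theorem IsTest.mul {S T : ∀ N, Mat N → ℂ} (hS : IsTest S) (hT : IsTest T) :
    IsTest fun N U => S N U * T N U := by
  obtain ⟨L, C, hS⟩ := hS
  obtain ⟨M, D, hT⟩ := hT
  refine ⟨fun N U => T N U • L N U + S N U • M N U, C * D + D * C + C * D, fun N => ?_⟩
  obtain ⟨hS1, hS2, hS3, hS4⟩ := hS N
  obtain ⟨hT1, hT2, hT3, hT4⟩ := hT N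
  refine ⟨by fun_prop, by fun_prop, fun U hU => ?_, ?_⟩
  · obtain ⟨h1, h2⟩ := hS3 U hU
    obtain ⟨h3, h4⟩ := hT3 U hU
    have hC : 0 ≤ C := (norm_nonneg _).trans h1
    have hD : 0 ≤ D := (norm_nonneg _).trans h3
    have h5 : ‖S N U * T N U‖ ≤ C * D := by rw [norm_mul]; gcongr
    have h6 : ‖T N U • L N U + S N U • M N U‖ ≤ D * C + C * D := by
      refine (norm_add_le _ _).trans ?_
      rw [norm_smul, norm_smul]
      gcongr
    have := mul_nonneg hC hD
    constructor <;> linarith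
  · convert hS4.mul hT4 using 3 with X U
    rw [mul_add, ntr_add, mul_smul_comm, mul_smul_comm, ntr_smul, ntr_smul, mul_comm (T N U)]

theorem isTest_ntr_word {w : List Letter} (hw : ∀ x ∈ w, UniformlyBounded x.2) :
    IsTest fun _ U => ntr (word U w) := by
  obtain ⟨K, hK⟩ := exists_norm_word_le hw
  obtain ⟨L, hL⟩ := exists_norm_wordGrad_le hw
  refine ⟨fun N U => wordGrad U 1 w, max K |L|, fun N => ⟨by fun_prop,
    continuous_wordGrad w continuous_const, fun U hU => ⟨?_, ?_⟩, ?_⟩⟩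
  · exact (norm_ntr_le _).trans ((hK N U hU).trans (le_max_left _ _))
  · refine (hL N U hU 1).trans (le_trans ?_ (le_max_right _ _))
    have h1 : ‖(1 : Mat N)‖ ≤ 1 := norm_le_one_of_mem_unitaryGroup (one_mem _)
    calc L * ‖(1 : Mat N)‖ ≤ |L| * 1 :=
          mul_le_mul (le_abs_self L) h1 (norm_nonneg _) (abs_nonneg L)
      _ = |L| := mul_one _
  · have h := (hasLeftDeriv_word (N := N) w).ntr_mul 1
    simp only [ntr_mul_wordDeriv] at h
    simpa only [one_mul] using h

section Freeness

/-- Continuous functions of the unitary whose expectation tends to zero. -/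
def Negligible (ν : ∀ N, Measure (Mat N)) (f : ∀ N, Mat N → ℂ) : Prop :=
  (∀ N, Continuous (f N)) ∧ Tendsto (fun N => ∫ U, f N U ∂ν N) atTop (𝓝 0)

/-- Words of bounded letters with asymptotically vanishing traces and alternating indices. -/
def Alternating (w : List Letter) : Prop :=
  w.IsChain (fun x y => x.1 ≠ y.1) ∧
    ∀ x ∈ w, UniformlyBounded x.2 ∧ Tendsto (fun N => ntr (x.2 N)) atTop (𝓝 0)

theorem Alternating.left {l l' : List Letter} (h : Alternating (l ++ l')) : Alternating l :=
  ⟨h.1.left_of_append, fun x hx => h.2 x (by simp [hx])⟩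

theorem Alternating.bounded {w : List Letter} (h : Alternating w) :
    ∀ x ∈ w, UniformlyBounded x.2 := fun x hx => (h.2 x hx).1

variable {ν : ∀ N, Measure (Mat N)}

theorem Negligible.zero : Negligible ν fun _ _ => 0 :=
  ⟨fun _ => continuous_const, by simp⟩

theorem Negligible.add (hν : ∀ N, IsHaarUnitaryLaw N (ν N)) {f g : ∀ N, Mat N → ℂ}
    (hf : Negligible ν f) (hg : Negligible ν g) : Negligible ν fun N U => f N U + g N U := by
  refine ⟨fun N => (hf.1 N).add (hg.1 N), ?_⟩
  have := hf.2.add hg.2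
  rw [add_zero] at this
  refine this.congr fun N => ?_
  rw [integral_add (integrable_of_continuous (hν N) (hf.1 N))
    (integrable_of_continuous (hν N) (hg.1 N))]

theorem Negligible.neg {f : ∀ N, Mat N → ℂ} (hf : Negligible ν f) :
    Negligible ν fun N U => -f N U := by
  refine ⟨fun N => (hf.1 N).neg, ?_⟩
  have := hf.2.neg
  rw [neg_zero] at this
  refine this.congr fun N => ?_
  rw [integral_neg]

theorem Negligible.sub (hν : ∀ N, IsHaarUnitaryLaw N (ν N)) {f g : ∀ N, Mat N → ℂ}
    (hf : Negligible ν f) (hg : Negligible ν g) : Negligible ν fun N U => f N U - g N U := by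
  simpa only [sub_eq_add_neg] using hf.add hν hg.neg

theorem Negligible.congr (hν : ∀ N, IsHaarUnitaryLaw N (ν N)) {f g : ∀ N, Mat N → ℂ}
    (hf : Negligible ν f) (hg : ∀ N, Continuous (g N))
    (h : ∀ N, ∀ U ∈ Matrix.unitaryGroup (Fin N) ℂ, f N U = g N U) : Negligible ν g :=
  ⟨hg, hf.2.congr fun N => integral_congr_ae ((ae_mem_unitaryGroup (hν N)).mono (h N))⟩

theorem negligible_splitSum (hν : ∀ N, IsHaarUnitaryLaw N (ν N)) {w : List Letter}
    (hw : ∀ x ∈ w, UniformlyBounded x.2) {T : ∀ N, Mat N → ℂ} (hT : IsTest T) :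
    Negligible ν fun N U => splitSum U [] w * T N U := by
  have hTc := hT.continuous
  refine ⟨fun N => by have := hTc N; fun_prop, ?_⟩
  obtain ⟨M, C, h⟩ := hT
  obtain ⟨K, hK⟩ := exists_norm_word_le hw
  simp only [fun N => schwinger_dyson (hν N) (h N).1 (h N).2.1 (h N).2.2.2 w]
  have hlim : Tendsto (fun N : ℕ => ((N : ℝ)⁻¹) ^ 2 * (K * C)) atTop (𝓝 0) := by
    simpa using (tendsto_inv_atTop_nhds_zero_nat (𝕜 := ℝ)).pow 2 |>.mul_const (K * C)
  refine squeeze_zero_norm (fun N => ?_) hlim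
  have := (hν N).1
  rw [norm_neg, norm_mul, norm_pow, norm_inv, Complex.norm_natCast]
  refine mul_le_mul_of_nonneg_left ?_ (by positivity)
  refine (norm_integral_le_of_norm_le_const (C := K * C)
    ((ae_mem_unitaryGroup (hν N)).mono fun U hU => ?_)).trans (by simp)
  exact (norm_ntr_le _).trans ((norm_mul_le _ _).trans (mul_le_mul (hK N U hU)
    ((h N).2.2.1 U hU).2 (norm_nonneg _) ((norm_nonneg _).trans (hK N U hU))))

/-- If all shorter alternating words are negligible, then in the sum over the splittings
only the one whose first factor is the whole word survives. -/
theorem negligible_splitSum_add (hν : ∀ N, IsHaarUnitaryLaw N (ν N)) (l : List Letter)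
    (y : Letter) {pre : List Letter} (hpre : pre ≠ []) (hw : Alternating (pre ++ (l ++ [y])))
    (ih : ∀ p : List Letter, p ≠ [] → p.length < (pre ++ (l ++ [y])).length → Alternating p →
      ∀ T, IsTest T → Negligible ν fun N U => ntr (word U p) * T N U)
    {T : ∀ N, Mat N → ℂ} (hT : IsTest T) :
    Negligible ν fun N U => splitSum U pre (l ++ [y]) * T N U +
      if y.1 = 1 then ntr (word U (pre ++ (l ++ [y]))) * T N U else 0 := by
  have hTc := hT.continuous
  induction l generalizing pre with
  | nil =>
    have hbd := hw.bounded
    rw [List.nil_append] at *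
    by_cases hy : y.1 = 1
    · refine (ih pre hpre (by simp) hw.left _
        ((isTest_ntr_word (w := [y]) fun x hx => hbd x (by simp_all)).mul hT)).congr hν
        (fun N => ?_) fun N U _ => ?_
      · have := hTc N
        simp only [hy, if_true]
        fun_prop
      · simp only [splitSum, hy, if_true, word_nil, ntr_mul_ntr_one]
        ring
    · simpa [splitSum, hy] using Negligible.zero
  | cons x l hl =>
    have happ : pre ++ (x :: l ++ [y]) = (pre ++ [x]) ++ (l ++ [y]) := by simp
    have hbd := hw.bounded
    have hrec := hl (pre := pre ++ [x]) (by simp) (happ ▸ hw) (happ ▸ ih)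
    rw [← happ] at hrec
    by_cases hx : x.1 = 1
    · have h1 := ih pre hpre (by simp) hw.left _
        ((isTest_ntr_word (w := x :: l ++ [y]) fun z hz => hbd z (by simp_all)).mul hT)
      have h2 := ih (pre ++ [x]) (by simp) (by simp) (happ ▸ hw).left _
        ((isTest_ntr_word (w := l ++ [y]) fun z hz => hbd z (by
          simp only [List.mem_append, List.mem_cons] at hz ⊢; tauto)).mul hT)
      refine ((h1.sub hν h2).add hν hrec).congr hν (fun N => ?_) fun N U _ => ?_
      · have := hTc N
        split_ifs <;> fun_prop
      · simp only [List.cons_append, splitSum, hx, if_true]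
        ring
    · simpa only [List.cons_append, splitSum, hx, if_false, zero_add] using hrec

theorem negligible_singleton (hν : ∀ N, IsHaarUnitaryLaw N (ν N)) {x : Letter}
    (hx : Tendsto (fun N => ntr (x.2 N)) atTop (𝓝 0)) {T : ∀ N, Mat N → ℂ} (hT : IsTest T) :
    Negligible ν fun N U => ntr (word U [x]) * T N U := by
  have hTc := hT.continuous
  obtain ⟨M, C, h⟩ := hT
  have : Negligible ν fun N U => ntr (x.2 N) * T N U := by
    refine ⟨fun N => by have := hTc N; fun_prop, ?_⟩
    simp only [integral_const_mul]
    refine squeeze_zero_norm (a := fun N => ‖ntr (x.2 N)‖ * C) (fun N => ?_)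
      (by simpa using hx.norm.mul_const C)
    have := (hν N).1
    rw [norm_mul]
    refine mul_le_mul_of_nonneg_left ?_ (norm_nonneg _)
    exact (norm_integral_le_of_norm_le_const (C := C)
      ((ae_mem_unitaryGroup (hν N)).mono fun U hU => ((h N).2.2.1 U hU).1)).trans (by simp)
  refine this.congr hν (fun N => by have := hTc N; fun_prop) fun N U hU => ?_
  rw [word_cons, word_nil, mul_one, ntr_rot _ hU]

/-- Cyclic merging of the two extreme letters of a word, when they have the same index. -/
theorem ntr_word_merge {N : ℕ} {U : Mat N} (hU : U ∈ Matrix.unitaryGroup (Fin N) ℂ)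
    {x y : Letter} (hxy : x.1 = y.1) (l : List Letter) :
    ntr (word U (x :: (l ++ [y]))) =
      ntr (word U ((x.1, fun N => y.2 N * x.2 N - ntr (y.2 N * x.2 N) • 1) :: l)) +
        ntr (word U l) * ntr (word U [(x.1, fun N => y.2 N * x.2 N)]) := by
  simp only [word_cons, word_append, word_nil, mul_one]
  rw [← mul_assoc, ntr_mul_comm, ← hxy, rot_sub, rot_smul, rot_one _ hU, ntr_rot _ hU, sub_mul,
    ntr_sub, smul_mul_assoc, one_mul, ntr_smul, rot_mul _ hU]
  rw [mul_assoc]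
  ring

theorem negligible_alternating (hν : ∀ N, IsHaarUnitaryLaw N (ν N)) (w : List Letter)
    (hw0 : w ≠ []) (hw : Alternating w) {T : ∀ N, Mat N → ℂ} (hT : IsTest T) :
    Negligible ν fun N U => ntr (word U w) * T N U := by
  induction hn : w.length using Nat.strong_induction_on generalizing w T with
  | _ n ih =>
  subst hn
  have ih' : ∀ p : List Letter, p ≠ [] → p.length < w.length → Alternating p →
      ∀ T, IsTest T → Negligible ν fun N U => ntr (word U p) * T N U :=
    fun p hp hlen hpa T hT => ih p.length hlen p hp hpa hT rfl
  have hTc := hT.continuous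
  have hbd := hw.bounded
  obtain ⟨x, w, rfl⟩ := List.exists_cons_of_ne_nil hw0
  rcases List.eq_nil_or_concat' w with rfl | ⟨l, y, rfl⟩
  · exact negligible_singleton hν (hw.2 x (by simp)).2 hT
  by_cases hxy : x.1 = y.1
  · rcases l with _ | ⟨z, l⟩
    · exact absurd hxy (by simpa using hw.1)
    have hchain : (x :: z :: l).IsChain (fun x y => x.1 ≠ y.1) :=
      List.IsChain.left_of_append (l₂ := [y]) (by simpa using hw.1)
    rw [List.isChain_cons_cons] at hchain
    have hmem : ∀ u ∈ z :: l, u ∈ x :: (z :: l ++ [y]) := fun u hu => by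
      simp only [List.mem_cons, List.mem_append] at hu ⊢; tauto
    have hprod : UniformlyBounded fun N => y.2 N * x.2 N :=
      (hbd y (by simp)).mul (hbd x (by simp))
    have hc : Tendsto (fun N : ℕ => ntr (y.2 N * x.2 N - ntr (y.2 N * x.2 N) • 1)) atTop
        (𝓝 0) := by
      simp only [ntr_sub, ntr_smul, ntr_mul_ntr_one, sub_self]
      exact tendsto_const_nhds
    have h1 := ih' ((x.1, fun N => y.2 N * x.2 N - ntr (y.2 N * x.2 N) • 1) :: z :: l)
      (by simp) (by simp) ⟨List.isChain_cons_cons.2 hchain, fun u hu => by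
        rcases List.mem_cons.1 hu with rfl | hu
        · exact ⟨hprod.center, hc⟩
        · exact hw.2 u (hmem u hu)⟩ T hT
    have h2 := ih' (z :: l) (by simp) (by simp) ⟨hchain.2, fun u hu => hw.2 u (hmem u hu)⟩ _
      ((isTest_ntr_word (w := [(x.1, fun N => y.2 N * x.2 N)]) (by simpa using hprod)).mul hT)
    refine (h1.add hν h2).congr hν (fun N => by have := hTc N; fun_prop) fun N U hU => ?_
    rw [ntr_word_merge hU hxy]
    ring
  · have hsplit := negligible_splitSum hν hbd hT
    have hrest := negligible_splitSum_add hν l y (pre := [x]) (by simp) (by simpa using hw)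
      (by simpa using ih') hT
    have hcont : ∀ N, Continuous fun U : Mat N => ntr (word U (x :: (l ++ [y]))) * T N U :=
      fun N => by have := hTc N; fun_prop
    by_cases hx : x.1 = 1
    · have hy : ¬ y.1 = 1 := fun h => hxy (hx.trans h.symm)
      have h1 := ih' [x] (by simp) (by simp) (Alternating.left (l' := l ++ [y]) (by simpa using hw))
        _ ((isTest_ntr_word (w := l ++ [y]) fun u hu => hbd u (by simp_all)).mul hT)
      refine ((hsplit.sub hν hrest).add hν h1).congr hν hcont fun N U _ => ?_
      simp only [splitSum, hx, hy, if_true, if_false, word_nil, List.nil_append]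
      rw [mul_comm (ntr 1), ntr_mul_ntr_one]
      ring
    · have hy : y.1 = 1 := by omega
      refine (hrest.sub hν hsplit).congr hν hcont fun N U _ => ?_
      simp only [splitSum, hx, hy, if_true, if_false, List.nil_append, List.singleton_append]
      ring

end Freeness

section Limits

open Polynomial

theorem rot_add {N : ℕ} (c : Fin 2) (U P Q : Mat N) : rot c U (P + Q) = rot c U P + rot c U Q := by
  unfold rot
  split_ifs <;> noncomm_ring

/-- Conjugation by a unitary matrix as an algebra homomorphism. -/
def rotHom {N : ℕ} (c : Fin 2) {U : Mat N} (hU : U ∈ Matrix.unitaryGroup (Fin N) ℂ) :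
    Mat N →ₐ[ℂ] Mat N :=
  AlgHom.ofLinearMap
    { toFun := rot c U, map_add' := rot_add c U, map_smul' := rot_smul c U }
    (rot_one c hU) (rot_mul c hU)

/-- Noncommutative polynomials in two variables. -/
abbrev NCPoly := FreeAlgebra ℂ (Fin 2)

variable (D : Fin 2 → ∀ N, Mat N) (ν : ∀ N, Measure (Mat N))

/-- Evaluation of a noncommutative polynomial at `D 0` and the conjugate of `D 1` by `U`. -/
noncomputable def evalAt (N : ℕ) (U : Mat N) : NCPoly →ₐ[ℂ] Mat N :=
  FreeAlgebra.lift ℂ fun c => rot c U (D c N)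

noncomputable def meanTrace (x : NCPoly) (N : ℕ) : ℂ := ∫ U, ntr (evalAt D N U x) ∂ν N

@[fun_prop]
theorem continuous_evalAt (N : ℕ) (x : NCPoly) : Continuous fun U => evalAt D N U x := by
  induction x using FreeAlgebra.induction with
  | grade0 r => simp only [AlgHom.commutes]; exact continuous_const
  | grade1 c => simp only [evalAt, FreeAlgebra.lift_ι_apply]; fun_prop
  | mul a b ha hb => simp only [map_mul]; fun_prop
  | add a b ha hb => simp only [map_add]; fun_prop

theorem evalAt_aeval {N : ℕ} {U : Mat N} (hU : U ∈ Matrix.unitaryGroup (Fin N) ℂ) (c : Fin 2)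
    (p : ℂ[X]) :
    evalAt D N U (aeval (FreeAlgebra.ι ℂ c) p) = rot c U (aeval (D c N) p) := by
  rw [← aeval_algHom_apply, evalAt, FreeAlgebra.lift_ι_apply]
  exact aeval_algHom_apply (rotHom c hU) (D c N) p

variable {ν}

theorem meanTrace_add (hν : ∀ N, IsHaarUnitaryLaw N (ν N)) (x y : NCPoly) (N : ℕ) :
    meanTrace D ν (x + y) N = meanTrace D ν x N + meanTrace D ν y N := by
  simp only [meanTrace, map_add, ntr_add]
  exact integral_add (integrable_of_continuous (hν N) (by fun_prop))
    (integrable_of_continuous (hν N) (by fun_prop))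

theorem meanTrace_smul (k : ℂ) (x : NCPoly) (N : ℕ) :
    meanTrace D ν (k • x) N = k * meanTrace D ν x N := by
  simp only [meanTrace, map_smul, ntr_smul]
  exact integral_const_mul _ _

theorem meanTrace_aeval (hν : ∀ N, IsHaarUnitaryLaw N (ν N)) (c : Fin 2) (p : ℂ[X]) (N : ℕ) :
    meanTrace D ν (aeval (FreeAlgebra.ι ℂ c) p) N = ntr (aeval (D c N) p) := by
  have := (hν N).1
  rw [meanTrace, integral_congr_ae (g := fun _ => ntr (aeval (D c N) p))
    ((ae_mem_unitaryGroup (hν N)).mono fun U hU => ?_)]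
  · simp
  · simp only [evalAt_aeval D hU, ntr_rot _ hU]

theorem tendsto_meanTrace_one (hν : ∀ N, IsHaarUnitaryLaw N (ν N)) :
    Tendsto (meanTrace D ν 1) atTop (𝓝 1) := by
  refine tendsto_const_nhds.congr' ?_
  filter_upwards [eventually_gt_atTop 0] with N hN
  have := (hν N).1
  have hN' : (N : ℂ) ≠ 0 := by exact_mod_cast hN.ne'
  simp [meanTrace, ntr, hN']

/-- The letter whose matrices are the values of the polynomial `x.2` at `D x.1`. -/
noncomputable def polyLetter (x : Fin 2 × ℂ[X]) : Letter := (x.1, fun N => aeval (D x.1 N) x.2)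

noncomputable def polyWord (L : List (Fin 2 × ℂ[X])) : NCPoly :=
  (L.map fun x => aeval (FreeAlgebra.ι ℂ x.1) x.2).prod

theorem meanTrace_polyWord (hν : ∀ N, IsHaarUnitaryLaw N (ν N)) (L : List (Fin 2 × ℂ[X])) (N : ℕ) :
    meanTrace D ν (polyWord L) N = ∫ U, ntr (word U (L.map (polyLetter D))) ∂ν N := by
  refine integral_congr_ae ((ae_mem_unitaryGroup (hν N)).mono fun U hU => ?_)
  simp only [polyWord, word, map_list_prod, List.map_map]
  congr 3
  funext x
  exact evalAt_aeval D hU _ _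

theorem UniformlyBounded.aeval {P : ∀ N, Mat N} (hP : UniformlyBounded P) (p : ℂ[X]) :
    UniformlyBounded fun N => aeval (P N) p := by
  have hC : ∀ k : ℂ, UniformlyBounded fun N => k • (1 : Mat N) := fun k =>
    UniformlyBounded.smul_one (k := fun _ => k) fun _ => le_rfl
  induction p using Polynomial.induction_on with
  | C k => simpa only [aeval_C, Algebra.algebraMap_eq_smul_one] using hC k
  | add p q hp hq => simpa only [map_add] using hp.add hq
  | monomial n k h =>
    simpa only [pow_succ, ← mul_assoc, map_mul, aeval_X] using h.mul hP

theorem exists_tendsto_ntr_aeval {P : ∀ N, Mat N}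
    (hP : ∀ k : ℕ, ∃ l, Tendsto (fun N => ntr (P N ^ k)) atTop (𝓝 l)) (p : ℂ[X]) :
    ∃ l, Tendsto (fun N => ntr (aeval (P N) p)) atTop (𝓝 l) := by
  induction p using Polynomial.induction_on' with
  | add p q hp hq =>
    obtain ⟨l, hl⟩ := hp
    obtain ⟨l', hl'⟩ := hq
    exact ⟨l + l', by simpa only [map_add, ntr_add] using hl.add hl'⟩
  | monomial n k =>
    obtain ⟨l, hl⟩ := hP n
    refine ⟨k * l, ?_⟩
    simpa only [aeval_monomial, ← Algebra.smul_def, ntr_smul] using Tendsto.const_mul k hl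

variable {D}

/-- Alternating products of asymptotically centered polynomials have vanishing mean trace. -/
theorem tendsto_meanTrace_polyWord_zero (hν : ∀ N, IsHaarUnitaryLaw N (ν N))
    (hD : ∀ c, UniformlyBounded (D c)) {L : List (Fin 2 × ℂ[X])} (hL : L ≠ [])
    (hchain : L.IsChain fun x y => x.1 ≠ y.1)
    (hcent : ∀ x ∈ L, Tendsto (fun N => ntr (aeval (D x.1 N) x.2)) atTop (𝓝 0)) :
    Tendsto (meanTrace D ν (polyWord L)) atTop (𝓝 0) := by
  have h := negligible_alternating hν (L.map (polyLetter D)) (by simpa using hL)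
    ⟨(List.isChain_map _).2 hchain, fun y hy => by
      obtain ⟨x, hx, rfl⟩ := List.mem_map.1 hy
      exact ⟨(hD x.1).aeval x.2, hcent x hx⟩⟩ isTest_one
  refine h.2.congr fun N => ?_
  simp only [mul_one, meanTrace_polyWord D hν]

/-- The noncommutative polynomials whose mean trace converges. -/
def convergent (D : Fin 2 → ∀ N, Mat N) (hν : ∀ N, IsHaarUnitaryLaw N (ν N)) :
    Submodule ℂ NCPoly where
  carrier := {x | ∃ l, Tendsto (meanTrace D ν x) atTop (𝓝 l)}
  add_mem' := by
    rintro x y ⟨l, hl⟩ ⟨l', hl'⟩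
    exact ⟨l + l', (hl.add hl').congr fun N => (meanTrace_add D hν x y N).symm⟩
  zero_mem' := ⟨0, tendsto_const_nhds.congr fun N => by simp [meanTrace, ntr]⟩
  smul_mem' := by
    rintro k x ⟨l, hl⟩
    exact ⟨k * l, (hl.const_mul k).congr fun N => (meanTrace_smul D k x N).symm⟩

theorem polyWord_append (L L' : List (Fin 2 × ℂ[X])) :
    polyWord (L ++ L') = polyWord L * polyWord L' := by
  simp [polyWord]

theorem polyWord_cons (x : Fin 2 × ℂ[X]) (L : List (Fin 2 × ℂ[X])) :
    polyWord (x :: L) = aeval (FreeAlgebra.ι ℂ x.1) x.2 * polyWord L := by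
  simp [polyWord]

/-- Modulo shorter words, the letters of a word may be replaced by their centered versions. -/
theorem polyWord_sub_centered_mem {V : Submodule ℂ NCPoly} (m : Fin 2 × ℂ[X] → ℂ)
    (L pre : List (Fin 2 × ℂ[X]))
    (hV : ∀ L' : List (Fin 2 × ℂ[X]), L'.length < (pre ++ L).length → polyWord L' ∈ V) :
    polyWord (pre ++ L) - polyWord (pre ++ L.map fun x => (x.1, x.2 - C (m x))) ∈ V := by
  induction L generalizing pre with
  | nil => simp
  | cons x L ih =>
    have h1 := ih (pre ++ [(x.1, x.2 - C (m x))]) (by simpa using hV)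
    have h2 := V.smul_mem (m x) (hV (pre ++ L) (by simp))
    convert V.add_mem h1 h2 using 1
    simp only [List.map_cons, polyWord_append, polyWord_cons, map_sub, aeval_C,
      Algebra.algebraMap_eq_smul_one, List.append_assoc, List.singleton_append, sub_mul, mul_sub,
      smul_mul_assoc, mul_smul_comm, one_mul]
    abel

theorem polyWord_mem_convergent (hν : ∀ N, IsHaarUnitaryLaw N (ν N))
    (hD : ∀ c, UniformlyBounded (D c))
    (hm : ∀ c, ∀ k : ℕ, ∃ l, Tendsto (fun N => ntr (D c N ^ k)) atTop (𝓝 l))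
    (L : List (Fin 2 × ℂ[X])) : polyWord L ∈ convergent D hν := by
  induction hn : L.length using Nat.strong_induction_on generalizing L with
  | _ n ih =>
  subst hn
  have ih' : ∀ L' : List (Fin 2 × ℂ[X]), L'.length < L.length → polyWord L' ∈ convergent D hν :=
    fun L' h => ih _ h L' rfl
  by_cases hchain : L.IsChain fun x y => x.1 ≠ y.1
  · rcases eq_or_ne L [] with rfl | hL
    · exact ⟨1, tendsto_meanTrace_one D hν⟩
    choose m hm' using fun x : Fin 2 × ℂ[X] => exists_tendsto_ntr_aeval (hm x.1) x.2
    have hsub := polyWord_sub_centered_mem m L [] ih'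
    rw [← sub_add_cancel (polyWord L) (polyWord (L.map fun x => (x.1, x.2 - C (m x))))]
    refine add_mem hsub ⟨0, tendsto_meanTrace_polyWord_zero hν hD (by simpa using hL)
      ((List.isChain_map _).2 hchain) fun y hy => ?_⟩
    obtain ⟨x, -, rfl⟩ := List.mem_map.1 hy
    have h1 : Tendsto (fun N : ℕ => ntr (1 : Mat N)) atTop (𝓝 1) := by
      refine tendsto_const_nhds.congr' ?_
      filter_upwards [eventually_gt_atTop 0] with N hN
      have hN' : (N : ℂ) ≠ 0 := by exact_mod_cast hN.ne'
      simp [ntr, hN']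
    simpa only [map_sub, aeval_C, Algebra.algebraMap_eq_smul_one, ntr_sub, ntr_smul, mul_one,
      sub_self] using (hm' x).sub (h1.const_mul (m x))
  · rw [List.isChain_iff_forall_rel_of_append_cons_cons] at hchain
    push Not at hchain
    obtain ⟨x, y, L₁, L₂, rfl, hxy⟩ := hchain
    have h := ih' (L₁ ++ (x.1, x.2 * y.2) :: L₂) (by simp)
    simpa only [polyWord_append, polyWord_cons, map_mul, mul_assoc, hxy] using h

theorem mem_convergent (hν : ∀ N, IsHaarUnitaryLaw N (ν N))
    (hD : ∀ c, UniformlyBounded (D c))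
    (hm : ∀ c, ∀ k : ℕ, ∃ l, Tendsto (fun N => ntr (D c N ^ k)) atTop (𝓝 l))
    (x : NCPoly) : x ∈ convergent D hν := by
  have hx : x ∈ Submodule.span ℂ
      (Submonoid.closure (Set.range (FreeAlgebra.ι ℂ : Fin 2 → NCPoly)) : Set NCPoly) := by
    rw [← Algebra.adjoin_eq_span, FreeAlgebra.adjoin_range_ι]
    trivial
  refine Submodule.span_le.2 (fun y hy => ?_) hx
  obtain ⟨l, hl, rfl⟩ := Submonoid.exists_list_of_mem_closure hy
  choose! g hg using hl
  have := polyWord_mem_convergent hν hD hm (l.map fun z => (g z, X))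
  rw [polyWord, List.map_map] at this
  rwa [List.map_congr_left (g := id) fun z hz => by simp [hg z hz], List.map_id] at this

/-- The limiting noncommutative probability space. -/
noncomputable def limitSpace (hν : ∀ N, IsHaarUnitaryLaw N (ν N))
    (h : ∀ x, x ∈ convergent D hν) : NCProbSpace where
  A := NCPoly
  phi x := (h x).choose
  phi_add x y := tendsto_nhds_unique (h (x + y)).choose_spec
    (((h x).choose_spec.add (h y).choose_spec).congr fun N => (meanTrace_add D hν x y N).symm)
  phi_smul k x := tendsto_nhds_unique (h (k • x)).choose_spec
    (((h x).choose_spec.const_mul k).congr fun N => (meanTrace_smul D k x N).symm)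
  phi_one := tendsto_nhds_unique (h 1).choose_spec (tendsto_meanTrace_one D hν)

theorem isFreeFamily_limitSpace (hν : ∀ N, IsHaarUnitaryLaw N (ν N))
    (hD : ∀ c, UniformlyBounded (D c)) (h : ∀ x, x ∈ convergent D hν) :
    IsFreeFamily (limitSpace hν h) (FreeAlgebra.ι ℂ : Fin 2 → NCPoly) := by
  intro m hm i p hi hp
  have hlim := tendsto_meanTrace_polyWord_zero hν hD (L := List.ofFn fun k => (i k, p k))
    (by rw [Ne, List.ofFn_eq_nil_iff]; omega) (List.isChain_ofFn.2 hi) fun x hx => by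
      obtain ⟨k, rfl⟩ := (List.mem_ofFn' _ _).1 hx
      have hk := (h (aeval (FreeAlgebra.ι ℂ (i k)) (p k))).choose_spec
      rw [show (h (aeval (FreeAlgebra.ι ℂ (i k)) (p k))).choose = 0 from hp k] at hk
      exact hk.congr fun N => meanTrace_aeval D hν (i k) (p k) N
  rw [polyWord, List.map_ofFn] at hlim
  exact tendsto_nhds_unique (h _).choose_spec hlim

end Limits

end RandomRotation

/-- Asymptotic freeness under random rotation.  If `A_N`, `B_N`
are uniformly bounded deterministic matrices with limiting moments `α_m`, `β_m`
and `U_N` are Haar unitary random matrices, then there are a noncommutative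
probability space and free elements `a`, `b` with moments `α`, `β` such that
`E[tr(A_N^{p_1} (U_N B_N U_N*)^{q_1} ⋯ A_N^{p_m} (U_N B_N U_N*)^{q_m})]`
converges to `φ(a^{p_1} b^{q_1} ⋯ a^{p_m} b^{q_m})`. -/
theorem asymptotic_freeness_random_rotation
    (A B : ∀ N : ℕ, Matrix (Fin N) (Fin N) ℂ)
    (hA : ∃ c : ℝ, ∀ N : ℕ, ‖Matrix.toEuclideanCLM (𝕜 := ℂ) (A N)‖ ≤ c)
    (hB : ∃ c : ℝ, ∀ N : ℕ, ‖Matrix.toEuclideanCLM (𝕜 := ℂ) (B N)‖ ≤ c)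
    (α β : ℕ → ℂ)
    (hα : ∀ m : ℕ, Filter.Tendsto (fun N : ℕ => (A N ^ m).trace / (N : ℂ))
      Filter.atTop (nhds (α m)))
    (hβ : ∀ m : ℕ, Filter.Tendsto (fun N : ℕ => (B N ^ m).trace / (N : ℂ))
      Filter.atTop (nhds (β m)))
    (ν : ∀ N : ℕ, Measure (Matrix (Fin N) (Fin N) ℂ))
    (hν : ∀ N : ℕ, IsHaarUnitaryLaw N (ν N)) :
    ∃ (P : NCProbSpace) (a b : P.A),
      IsFreeFamily P ![a, b] ∧
      (∀ m : ℕ, P.phi (a ^ m) = α m) ∧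
      (∀ m : ℕ, P.phi (b ^ m) = β m) ∧
      (∀ m : ℕ, 1 ≤ m → ∀ pe qe : Fin m → ℕ,
        Filter.Tendsto
          (fun N : ℕ => ∫ U,
            (List.ofFn fun l =>
              A N ^ pe l * (U * B N * U.conjTranspose) ^ qe l).prod.trace / (N : ℂ)
            ∂(ν N))
          Filter.atTop
          (nhds (P.phi ((List.ofFn fun l => a ^ pe l * b ^ qe l).prod)))) := by
  let D : Fin 2 → ∀ N, RandomRotation.Mat N := ![A, B]
  have hD : ∀ c, RandomRotation.UniformlyBounded (D c) := Fin.forall_fin_two.2 ⟨hA, hB⟩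
  have hm : ∀ c, ∀ k : ℕ, ∃ l, Filter.Tendsto (fun N => RandomRotation.ntr (D c N ^ k))
      Filter.atTop (nhds l) := Fin.forall_fin_two.2 ⟨fun k => ⟨α k, hα k⟩, fun k => ⟨β k, hβ k⟩⟩
  have h := RandomRotation.mem_convergent hν hD hm
  have hpow : ∀ c (k : ℕ), RandomRotation.meanTrace D ν (FreeAlgebra.ι ℂ c ^ k) =
      fun N => RandomRotation.ntr (D c N ^ k) := fun c k => by
    ext N
    simpa using RandomRotation.meanTrace_aeval D hν c (Polynomial.X ^ k) N
  have hpow0 : ∀ m, Filter.Tendsto (RandomRotation.meanTrace D ν (FreeAlgebra.ι ℂ 0 ^ m))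
      Filter.atTop (nhds (α m)) := fun m => (hpow 0 m).symm ▸ hα m
  have hpow1 : ∀ m, Filter.Tendsto (RandomRotation.meanTrace D ν (FreeAlgebra.ι ℂ 1 ^ m))
      Filter.atTop (nhds (β m)) := fun m => (hpow 1 m).symm ▸ hβ m
  have hι : (![FreeAlgebra.ι ℂ 0, FreeAlgebra.ι ℂ 1] : Fin 2 → RandomRotation.NCPoly) =
      FreeAlgebra.ι ℂ := by
    ext c
    fin_cases c <;> rfl
  refine ⟨RandomRotation.limitSpace hν h, FreeAlgebra.ι ℂ 0, FreeAlgebra.ι ℂ 1, ?_,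
    fun m => tendsto_nhds_unique (h _).choose_spec (hpow0 m),
    fun m => tendsto_nhds_unique (h _).choose_spec (hpow1 m), fun m _ pe qe => ?_⟩
  · exact hι.symm ▸ RandomRotation.isFreeFamily_limitSpace hν hD h
  · refine (h (List.ofFn fun l => FreeAlgebra.ι ℂ 0 ^ pe l * FreeAlgebra.ι ℂ 1 ^ qe l).prod
      ).choose_spec.congr fun N => ?_
    simp only [RandomRotation.meanTrace, map_list_prod, List.map_ofFn, Function.comp_def, map_mul,
      map_pow, RandomRotation.evalAt, FreeAlgebra.lift_ι_apply]
    rfl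
end
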